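/- arXiv:0805.1069 — 3 statements merged into one kernel-verified Lean document; each statement's English description precedes it below -/
import Mathlib

section
/- Every continuous map of a dendrite into itself has a fixed point. -/
open Set Filter Topology Metric unitInterval

section LocallyPathConnected

/-- Two points of a preconnected set are joined inside it by an eventually constant sequence
with steps shorter than `η`. -/
lemma IsPreconnected.exists_chain {X : Type*} [PseudoMetricSpace X] {S : Set X}
    (hS : IsPreconnected S) {η : ℝ} (hη : 0 < η) {x y : X} (hx : x ∈ S) (hy : y ∈ S) :
    ∃ (M : ℕ) (c : ℕ → X), c 0 = x ∧ (∀ k, M ≤ k → c k = y) ∧ (∀ k, c k ∈ S) ∧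
      ∀ k, dist (c k) (c (k + 1)) < η := by
  have key : Relation.ReflTransGen (fun u v => u ∈ S ∧ v ∈ S ∧ dist u v < η) x y := by
    refine hS.induction₂'
      (Relation.ReflTransGen (fun u v => u ∈ S ∧ v ∈ S ∧ dist u v < η)) ?_ ?_ hx hy
    · intro z hz
      filter_upwards [self_mem_nhdsWithin, mem_nhdsWithin_of_mem_nhds (ball_mem_nhds z hη)]
        with w hw hwz
      exact ⟨.single ⟨hz, hw, by rwa [dist_comm]⟩, .single ⟨hw, hz, hwz⟩⟩
    · exact fun u v w _ _ _ => Relation.ReflTransGen.trans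
  induction key using Relation.ReflTransGen.head_induction_on with
  | refl => exact ⟨0, fun _ => y, rfl, fun _ _ => rfl, fun _ => hy, by simpa using hη⟩
  | @head a v h _ ih =>
    obtain ⟨M, c, h0, hM, hcS, hd⟩ := ih h.2.1
    refine ⟨M + 1, fun k => Nat.casesOn k a c, rfl, ?_, ?_, ?_⟩
    · rintro (_ | k) hk
      · omega
      · exact hM k (by omega)
    · rintro (_ | k)
      · exact h.1
      · exact hcS k
    · rintro (_ | k)
      · simpa [h0] using h.2.2
      · exact hd k

/-- A compact locally connected metric space is uniformly locally connected. -/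
lemma exists_isPreconnected_of_dist_lt {X : Type*} [PseudoMetricSpace X] [CompactSpace X]
    [LocallyConnectedSpace X] {ε : ℝ} (hε : 0 < ε) :
    ∃ δ > 0, ∀ x y : X, dist x y < δ →
      ∃ S : Set X, IsPreconnected S ∧ x ∈ S ∧ y ∈ S ∧ S ⊆ ball x ε := by
  have hV : ∀ z : X, ∃ V : Set X, IsOpen V ∧ z ∈ V ∧ IsConnected V ∧ V ⊆ ball z (ε / 2) := by
    intro z
    obtain ⟨V, ⟨h1, h2, h3⟩, h4⟩ := (LocallyConnectedSpace.open_connected_basis z).mem_iff.1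
      (ball_mem_nhds z (half_pos hε))
    exact ⟨V, h1, h2, h3, h4⟩
  choose V hVo hVz hVc hVb using hV
  obtain ⟨δ, hδ, h⟩ := lebesgue_number_lemma_of_metric (isCompact_univ (X := X)) hVo
    (fun z _ => mem_iUnion.2 ⟨z, hVz z⟩)
  refine ⟨δ, hδ, fun x y hxy => ?_⟩
  obtain ⟨i, hi⟩ := h x (mem_univ x)
  have hx : x ∈ V i := hi (mem_ball_self hδ)
  refine ⟨V i, (hVc i).isPreconnected, hx, hi (by rwa [mem_ball, dist_comm]), fun w hw => ?_⟩
  have h1 := hVb i hx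
  have h2 := hVb i hw
  rw [mem_ball] at *
  linarith [dist_triangle_right w x i]

/-- A chain from `a` to `b` whose steps can be joined by preconnected sets of size `ε` can be
refined, uniformly in its links, to a chain with steps shorter than `η`. -/
lemma exists_refinement_of_chain {X : Type*} [PseudoMetricSpace X] {ε δ η : ℝ} (hη : 0 < η)
    (h : ∀ x y : X, dist x y < δ →
      ∃ S : Set X, IsPreconnected S ∧ x ∈ S ∧ y ∈ S ∧ S ⊆ ball x ε)
    {N : ℕ} {x : ℕ → X} {b : X} (hb : ∀ k, N ≤ k → x k = b)
    (hd : ∀ k, dist (x k) (x (k + 1)) < δ) :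
    ∃ (M : ℕ) (y : ℕ → X), 0 < M ∧ y 0 = x 0 ∧ (∀ k, N * M ≤ k → y k = b) ∧
      (∀ k, dist (y k) (y (k + 1)) < η) ∧ ∀ k, dist (y k) (x (k / M)) < ε := by
  have hc : ∀ i, ∃ (M : ℕ) (c : ℕ → X), c 0 = x i ∧ (∀ k, M ≤ k → c k = x (i + 1)) ∧
      (∀ k, dist (c k) (x i) < ε) ∧ (∀ k, dist (c k) (c (k + 1)) < η) := by
    intro i
    obtain ⟨S, hS, h1, h2, h3⟩ := h _ _ (hd i)
    obtain ⟨M, c, hc0, hcM, hcS, hcd⟩ := hS.exists_chain hη h1 h2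
    exact ⟨M, c, hc0, hcM, fun k => h3 (hcS k), hcd⟩
  have hε : ∀ z : X, dist z z < ε := fun z => by
    obtain ⟨S, -, h1, -, h3⟩ := h z z (by
      simpa using dist_nonneg.trans_lt (hd 0))
    exact h3 h1
  choose m c hc0 hcM hcx hcd using hc
  set M := (Finset.range N).sup m + 1
  have hM : 0 < M := Nat.succ_pos _
  have hmM : ∀ i < N, m i ≤ M := fun i hi =>
    (Finset.le_sup (Finset.mem_range.2 hi)).trans (Nat.le_succ _)
  refine ⟨M, fun k => if k / M < N then c (k / M) (k % M) else b, hM, ?_, ?_, ?_, ?_⟩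
  · by_cases hN : 0 < N
    · simp [hN, hc0]
    · simp [hN, hb 0 (by omega)]
  · intro k hk
    have : N ≤ k / M := (Nat.le_div_iff_mul_le hM).2 hk
    simp [this.not_gt]
  · intro k
    by_cases hk : k / M < N
    · by_cases hk' : k % M + 1 < M
      · have h1 : (k + 1) / M = k / M := by
          rw [Nat.div_eq_iff hM]
          have := Nat.div_add_mod k M
          have := Nat.mul_comm M (k / M)
          constructor <;> omega
        have h2 : (k + 1) % M = k % M + 1 := by
          rw [Nat.add_mod_of_add_mod_lt]
          · have : 1 < M := by omega
            rw [Nat.mod_eq_of_lt this]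
          · have : 1 < M := by omega
            rwa [Nat.mod_eq_of_lt this]
        simp only [h1, h2, hk, if_true]
        exact hcd _ _
      · have hlt := Nat.mod_lt k hM
        have hk1 : k + 1 = (k / M + 1) * M := by
          have := Nat.div_add_mod k M
          rw [Nat.add_mul, Nat.mul_comm]; omega
        have h1 : (k + 1) / M = k / M + 1 := by rw [hk1, Nat.mul_div_cancel _ hM]
        have h2 : (k + 1) % M = 0 := by rw [hk1, Nat.mul_mod_left]
        have h3 : dist (c (k / M) (k % M)) (x (k / M + 1)) < η := by
          have := hcd (k / M) (k % M)
          rwa [hcM (k / M) (k % M + 1) (by have := hmM _ hk; omega)] at this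
        simp only [h1, h2, hk, if_true]
        split_ifs with h4
        · rwa [hc0]
        · rwa [← hb (k / M + 1) (by omega)]
    · have h1 : ¬ (k + 1) / M < N := by
        have : k / M ≤ (k + 1) / M := Nat.div_le_div_right (by omega)
        omega
      simpa [hk, h1] using hη
  · intro k
    dsimp only
    split_ifs with hk
    · exact hcx _ _
    · rw [hb _ (not_lt.1 hk)]
      exact hε b

/-- In a compact locally connected metric space, sufficiently close points are joined by
small paths. -/
lemma exists_joinedIn_closedBall_of_dist_lt {X : Type*} [MetricSpace X] [CompactSpace X]
    [LocallyConnectedSpace X] {ε : ℝ} (hε : 0 < ε) :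
    ∃ δ > 0, ∀ a b : X, dist a b < δ → JoinedIn (closedBall a ε) a b := by
  have hεn : ∀ n : ℕ, 0 < ε / 2 / 2 ^ n := fun n => by positivity
  choose δ' hδ'0 hδ' using fun n => exists_isPreconnected_of_dist_lt (X := X) (hεn n)
  let δ : ℕ → ℝ := fun n => min (δ' n) (ε / 2 / 2 ^ n)
  have hδ0 : ∀ n, 0 < δ n := fun n => lt_min (hδ'0 n) (hεn n)
  refine ⟨δ 0, hδ0 0, fun a b hab => ?_⟩
  let P : ℕ → ℕ × (ℕ → X) → Prop := fun n s => 0 < s.1 ∧ s.2 0 = a ∧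
    (∀ k, s.1 ≤ k → s.2 k = b) ∧ ∀ k, dist (s.2 k) (s.2 (k + 1)) < δ n
  have hstep : ∀ n s, ∃ s', P n s → P (n + 1) s' ∧ ∃ M : ℕ, 0 < M ∧ s'.1 = s.1 * M ∧
      ∀ k, dist (s'.2 k) (s.2 (k / M)) < ε / 2 / 2 ^ n := by
    intro n s
    by_cases hs : P n s
    · obtain ⟨h0, ha, hb, hd⟩ := hs
      obtain ⟨M, y, hM, hy0, hyb, hyd, hyx⟩ := exists_refinement_of_chain (hδ0 (n + 1))
        (hδ' n) hb (fun k => (hd k).trans_le (min_le_left _ _))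
      exact ⟨(s.1 * M, y), fun _ => ⟨⟨Nat.mul_pos h0 hM, hy0.trans ha, hyb, hyd⟩,
        M, hM, rfl, hyx⟩⟩
    · exact ⟨s, fun h => absurd h hs⟩
  choose F hF using hstep
  let s0 : ℕ × (ℕ → X) := (1, fun k => if k = 0 then a else b)
  have hs0 : P 0 s0 := by
    refine ⟨one_pos, rfl, fun k hk => if_neg (by simp only [s0] at hk; omega), ?_⟩
    rintro (_ | k)
    · simpa [s0] using hab
    · simpa [s0] using hδ0 0
  let s : ℕ → ℕ × (ℕ → X) := fun n => Nat.rec s0 F n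
  have hs : ∀ n, P n (s n) := fun n => by
    induction n with
    | zero => exact hs0
    | succ n ih => exact (hF n _ ih).1
  let g : ℕ → I → X := fun n t => (s n).2 ⌊((s n).1 : ℝ) * t⌋₊
  have hg : ∀ t n, dist (g n t) (g (n + 1) t) ≤ ε / 2 / 2 ^ n := by
    intro t n
    obtain ⟨M, hM, hsM, hd⟩ := (hF n _ (hs n)).2
    have : ⌊((s n).1 : ℝ) * t⌋₊ = ⌊((s (n + 1)).1 : ℝ) * t⌋₊ / M := by
      have h1 : (s (n + 1)).1 = (s n).1 * M := hsM
      rw [← Nat.floor_div_natCast, h1]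
      congr 1
      push_cast
      field_simp
    rw [dist_comm]
    simp only [g]
    rw [this]
    exact (hd _).le
  choose G hG using fun t => cauchySeq_tendsto_of_complete
    (cauchySeq_of_le_geometric_two (hg t))
  have hgG : ∀ t n, dist (g n t) (G t) ≤ ε / 2 ^ n := fun t n =>
    dist_le_of_le_geometric_two_of_tendsto (hg t) (hG t) n
  have hg0 : ∀ n, g n 0 = a := fun n => by simp [g, (hs n).2.1]
  have hg1 : ∀ n, g n 1 = b := fun n => by simp [g, (hs n).2.2.1]
  have hG0 : G 0 = a := tendsto_nhds_unique (hG 0) (by simp [hg0])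
  have hG1 : G 1 = b := tendsto_nhds_unique (hG 1) (by simp [hg1])
  have hjump : ∀ n (u v : I), u ≤ v → ((s n).1 : ℝ) * (v - u) < 1 →
      dist (g n u) (g n v) < ε / 2 ^ n := by
    intro n u v huv h
    have hN : (0 : ℝ) < (s n).1 := by exact_mod_cast (hs n).1
    have huv' : (u : ℝ) ≤ v := huv
    have h1 : ⌊((s n).1 : ℝ) * u⌋₊ ≤ ⌊((s n).1 : ℝ) * v⌋₊ := by gcongr
    have h2 : ⌊((s n).1 : ℝ) * v⌋₊ ≤ ⌊((s n).1 : ℝ) * u⌋₊ + 1 := by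
      rw [← Nat.lt_add_one_iff, Nat.floor_lt (mul_nonneg hN.le v.2.1)]
      push_cast
      linarith [Nat.lt_floor_add_one (((s n).1 : ℝ) * u)]
    have h3 : (0 : ℝ) < ε / 2 ^ n := by positivity
    rcases (by omega : ⌊((s n).1 : ℝ) * v⌋₊ = ⌊((s n).1 : ℝ) * u⌋₊ ∨
      ⌊((s n).1 : ℝ) * v⌋₊ = ⌊((s n).1 : ℝ) * u⌋₊ + 1) with h4 | h4
    · simpa [g, h4] using h3
    · simp only [g, h4]
      refine ((hs n).2.2.2 _).trans_le ((min_le_right _ _).trans ?_)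
      gcongr
      linarith
  have hcont : Continuous G := by
    rw [Metric.continuous_iff]
    intro t r hr
    obtain ⟨n, hn⟩ := exists_pow_lt_of_lt_one (show 0 < r / (3 * ε) by positivity)
      (by norm_num : (1 / 2 : ℝ) < 1)
    have hn' : 3 * (ε / 2 ^ n) < r := by
      rw [lt_div_iff₀ (by positivity)] at hn
      calc 3 * (ε / 2 ^ n) = (1 / 2) ^ n * (3 * ε) := by rw [one_div, inv_pow]; ring
        _ < r := hn
    have hN : (0 : ℝ) < (s n).1 := by exact_mod_cast (hs n).1
    refine ⟨1 / (s n).1, by positivity, fun u hu => ?_⟩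
    have hu' : ((s n).1 : ℝ) * |(u : ℝ) - t| < 1 := by
      rw [lt_div_iff₀ hN, mul_comm] at hu
      exact hu
    have hut : dist (g n u) (g n t) < ε / 2 ^ n := by
      rcases le_total u t with h | h
      · refine hjump n u t h (lt_of_le_of_lt ?_ hu')
        gcongr
        rw [abs_sub_comm]
        exact le_abs_self _
      · rw [dist_comm]
        refine hjump n t u h (lt_of_le_of_lt ?_ hu')
        gcongr
        exact le_abs_self _
    have h1 := hgG u n
    have h2 := hgG t n
    rw [dist_comm] at h1
    linarith [dist_triangle4 (G u) (g n u) (g n t) (G t)]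
  refine ⟨⟨⟨G, hcont⟩, hG0, hG1⟩, fun t => ?_⟩
  change G t ∈ closedBall a ε
  rw [mem_closedBall, dist_comm]
  by_cases ht : t = 1
  · rw [ht, hG1]
    refine hab.le.trans ((min_le_right _ _).trans ?_)
    simp only [pow_zero]
    linarith
  · have h1 : g 0 t = a := by
      have : ⌊(t : ℝ)⌋₊ = 0 := by
        rw [Nat.floor_eq_zero]
        exact lt_of_le_of_ne t.2.2 (fun h => ht (Subtype.ext h))
      change (if ⌊((1 : ℕ) : ℝ) * t⌋₊ = 0 then a else b) = a
      simp [this]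
    simpa [h1] using hgG t 0

/-- A compact locally connected metric space is locally path connected. -/
lemma locallyPathConnectedSpace_of_compactSpace {X : Type*} [MetricSpace X] [CompactSpace X]
    [LocallyConnectedSpace X] : LocallyPathConnectedSpace X := by
  rw [locallyPathConnectedSpace_iff_pathComponentIn_mem_nhds]
  intro x u hu hxu
  obtain ⟨ε, hε, hεu⟩ := nhds_basis_closedBall.mem_iff.1 (hu.mem_nhds hxu)
  obtain ⟨δ, hδ, h⟩ := exists_joinedIn_closedBall_of_dist_lt (X := X) hε
  filter_upwards [ball_mem_nhds x hδ] with y hy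
  exact (h x y (by rwa [dist_comm])).mono hεu

end LocallyPathConnected

section Arc

/-- The running maximum of a continuous function on the unit interval. -/
noncomputable def runningMax (h : I → ℝ) (t : I) : ℝ :=
  sSup ((fun s => h (min s t)) '' univ)

lemma continuous_runningMax {h : I → ℝ} (hh : Continuous h) : Continuous (runningMax h) :=
  isCompact_univ.continuous_sSup (f := fun t s => h (min s t)) (by fun_prop)

lemma le_runningMax {h : I → ℝ} (hh : Continuous h) {s t : I} (hst : s ≤ t) :
    h s ≤ runningMax h t :=
  le_csSup (isCompact_univ.image (by fun_prop)).bddAbove ⟨s, mem_univ s, by simp [hst]⟩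

lemma runningMax_le {h : I → ℝ} {t : I} {r : ℝ} (hr : ∀ s ≤ t, h s ≤ r) :
    runningMax h t ≤ r :=
  csSup_le (univ_nonempty.image _) (by rintro _ ⟨s, -, rfl⟩; exact hr _ (min_le_right _ _))

lemma monotone_runningMax {h : I → ℝ} (hh : Continuous h) : Monotone (runningMax h) :=
  fun _ _ huv => runningMax_le fun _ hs => le_runningMax hh (hs.trans huv)

lemma runningMax_eq_of_forall_eq {h : I → ℝ} (hh : Continuous h) {u v : I} (huv : u ≤ v)
    (hc : ∀ w, u ≤ w → w ≤ v → h w = h u) : runningMax h u = runningMax h v := by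
  refine (monotone_runningMax hh huv).antisymm (runningMax_le fun s hs => ?_)
  rcases le_total s u with h1 | h1
  · exact le_runningMax hh h1
  · exact (hc s h1 hs).trans_le (le_runningMax hh le_rfl)

/-- A path with order-convex fibres can be reparametrised by a function which is constant
exactly where the path is. -/
lemma exists_monotone_factor {X : Type*} [MetricSpace X] {g : I → X} (hg : Continuous g)
    (hfib : ∀ u v w, u ≤ w → w ≤ v → g u = g v → g w = g u) :
    ∃ φ : I → ℝ, Continuous φ ∧ Monotone φ ∧ ∀ u v, φ u = φ v ↔ g u = g v := by
  let q := TopologicalSpace.denseSeq I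
  let h : ℕ → I → ℝ := fun n t => min (infDist (g t) (g '' Iic (q n))) 1
  have hh : ∀ n, Continuous (h n) := fun n =>
    ((continuous_infDist_pt _).comp hg).min continuous_const
  let ψ : ℕ → I → ℝ := fun n => runningMax (h n)
  have hψ0 : ∀ n t, 0 ≤ ψ n t := fun n t =>
    (le_min infDist_nonneg zero_le_one : 0 ≤ h n t).trans (le_runningMax (hh n) le_rfl)
  have hψ1 : ∀ n t, ψ n t ≤ 1 := fun n t => runningMax_le fun _ _ => min_le_right _ _
  have hsum : ∀ t, Summable fun n => (1 / 2 : ℝ) ^ n * ψ n t := fun t =>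
    Summable.of_nonneg_of_le (fun n => mul_nonneg (by positivity) (hψ0 n t))
      (fun n => mul_le_of_le_one_right (by positivity) (hψ1 n t)) summable_geometric_two
  let φ : I → ℝ := fun t => ∑' n, (1 / 2 : ℝ) ^ n * ψ n t
  have hmono : Monotone φ := fun u v huv => (hsum u).tsum_le_tsum
    (fun n => mul_le_mul_of_nonneg_left (monotone_runningMax (hh n) huv) (by positivity)) (hsum v)
  have hlt : ∀ u v, u < v → g u ≠ g v → φ u < φ v := by
    intro u v huv hne
    obtain ⟨w, ⟨huw, hwv⟩, hw⟩ : ∃ w, w ∈ Ioo u v ∧ g w ≠ g v := by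
      have h1 : ∀ᶠ w in 𝓝[>] u, g w ≠ g v :=
        mem_nhdsWithin_of_mem_nhds (hg.continuousAt.eventually_ne hne)
      have : (𝓝[>] u).NeBot := nhdsGT_neBot_of_exists_gt ⟨v, huv⟩
      have h2 : ∀ᶠ w in 𝓝[>] u, w ∈ Ioo u v := Ioo_mem_nhdsGT huv
      exact (h2.and h1).exists
    obtain ⟨n, hn⟩ : ∃ n, q n ∈ Ioo u v ∩ {w | g w ≠ g v} :=
      (TopologicalSpace.denseRange_denseSeq I).exists_mem_open
        (isOpen_Ioo.inter (isOpen_ne_fun hg continuous_const)) ⟨w, ⟨huw, hwv⟩, hw⟩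
    have h0 : ψ n u = 0 := le_antisymm (runningMax_le fun s hs => by
      simp only [h]
      rw [infDist_zero_of_mem (mem_image_of_mem g (mem_Iic.2 (hs.trans hn.1.1.le)))]
      exact min_le_left _ _) (hψ0 n u)
    have h1 : 0 < ψ n v := by
      refine lt_of_lt_of_le ?_ (le_runningMax (hh n) le_rfl)
      refine lt_min ?_ one_pos
      refine ((isClosed_Iic.isCompact.image hg).isClosed.notMem_iff_infDist_pos
        ⟨_, mem_image_of_mem g (mem_Iic.2 le_rfl)⟩).1 ?_
      rintro ⟨s, hs, hsv⟩
      exact hn.2 ((hfib s v (q n) hs hn.1.2.le hsv).trans hsv)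
    refine Summable.tsum_lt_tsum (i := n) (fun n => mul_le_mul_of_nonneg_left
      (monotone_runningMax (hh n) huv.le) (by positivity)) ?_ (hsum u) (hsum v)
    change (1 / 2 : ℝ) ^ n * ψ n u < (1 / 2 : ℝ) ^ n * ψ n v
    rw [h0]
    simpa using h1
  have heq : ∀ u v, u ≤ v → (φ u = φ v ↔ g u = g v) := by
    intro u v huv
    constructor
    · intro h
      by_contra hne
      exact (hlt u v (lt_of_le_of_ne huv (fun h' => hne (congrArg g h'))) hne).ne h
    · intro h'
      refine tsum_congr fun n => congrArg _ (runningMax_eq_of_forall_eq (hh n) huv ?_)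
      intro w h1 h2
      simp only [h, hfib u v w h1 h2 h']
  refine ⟨φ, ?_, hmono, fun u v => ?_⟩
  · refine continuous_tsum (fun n => continuous_const.mul (continuous_runningMax (hh n)))
      summable_geometric_two fun n t => ?_
    rw [Real.norm_of_nonneg (mul_nonneg (by positivity) (hψ0 n t))]
    exact mul_le_of_le_one_right (by positivity) (hψ1 n t)
  · rcases le_total u v with h | h
    · exact heq u v h
    · rw [eq_comm, heq v u h, eq_comm]

/-- A nonconstant path with order-convex fibres is an arc up to reparametrisation. -/
lemma exists_arc_of_ordConnected_fibers {X : Type*} [MetricSpace X] {g : I → X}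
    (hg : Continuous g) (hfib : ∀ u v w, u ≤ w → w ≤ v → g u = g v → g w = g u)
    (hne : g 0 ≠ g 1) :
    ∃ α : I → X, Continuous α ∧ Function.Injective α ∧ α 0 = g 0 ∧ α 1 = g 1 ∧
      range α ⊆ range g := by
  obtain ⟨φ, hφ, hmono, hiff⟩ := exists_monotone_factor hg hfib
  have hpos : 0 < φ 1 - φ 0 :=
    sub_pos.2 (lt_of_le_of_ne (hmono zero_le_one) (fun h => hne ((hiff 0 1).1 h)))
  let Φ : I → I := fun t => ⟨(φ t - φ 0) / (φ 1 - φ 0),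
    div_nonneg (sub_nonneg.2 (hmono (nonneg' (t := t)))) hpos.le,
    (div_le_one hpos).2 (sub_le_sub_right (hmono (le_one' (t := t))) _)⟩
  have hΦ : Continuous Φ := by
    refine Continuous.subtype_mk ?_ _
    fun_prop
  have hΦ0 : Φ 0 = 0 := Subtype.ext (by simp [Φ])
  have hΦ1 : Φ 1 = 1 := Subtype.ext (by simp [Φ, hpos.ne'])
  have hΦiff : ∀ u v, Φ u = Φ v ↔ g u = g v := by
    intro u v
    rw [← hiff, Subtype.ext_iff]
    simp only [Φ]
    rw [div_left_inj' hpos.ne', sub_left_inj]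
  have hsurj : Function.Surjective Φ := by
    intro y
    have := intermediate_value_Icc (zero_le_one : (0 : I) ≤ 1) hΦ.continuousOn
    rw [hΦ0, hΦ1] at this
    obtain ⟨t, -, ht⟩ := this ⟨nonneg', le_one'⟩
    exact ⟨t, ht⟩
  have hquot : IsQuotientMap Φ := hΦ.isClosedMap.isQuotientMap hΦ hsurj
  choose r hr using hsurj
  have hrg : ∀ t, g (r (Φ t)) = g t := fun t => (hΦiff _ _).1 (hr _)
  refine ⟨g ∘ r, ?_, ?_, ?_, ?_, ?_⟩
  · rw [hquot.continuous_iff]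
    convert hg using 1
    exact funext hrg
  · intro x y hxy
    rw [← hr x, ← hr y]
    exact (hΦiff _ _).2 hxy
  · simpa [hΦ0] using hrg 0
  · simpa [hΦ1] using hrg 1
  · rintro _ ⟨t, rfl⟩
    exact mem_range_self _

/-- The closed sets of parameters that remain after cutting out loops of the path `γ`. -/
def LoopErased {X : Type*} (γ : I → X) (C : Set I) : Prop :=
  IsClosed C ∧ 0 ∈ C ∧ 1 ∈ C ∧
    ∀ c ∈ C, ∀ d ∈ C, c < d → (∀ e ∈ C, e ≤ c ∨ d ≤ e) → γ c = γ d

lemma exists_minimal_loopErased {X : Type*} [MetricSpace X] {γ : I → X} (hγ : Continuous γ) :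
    ∃ C, Minimal (LoopErased γ) C := by
  suffices h : ∃ C ⊆ univ, Minimal (· ∈ {C | LoopErased γ C}) C by
    obtain ⟨C, -, hC⟩ := h
    exact ⟨C, hC⟩
  refine zorn_superset_nonempty {C | LoopErased γ C} ?_ univ ?_
  · intro K hK hchain hne
    refine ⟨⋂₀ K, ⟨isClosed_sInter fun C hC => (hK hC).1, fun C hC => (hK hC).2.1,
      fun C hC => (hK hC).2.2.1, ?_⟩, fun C hC => sInter_subset_of_mem hC⟩
    intro c hc d hd hcd hgap
    obtain ⟨p, hcp, hpd⟩ := exists_between hcd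
    have key : ∀ u v, c < u → u ≤ p → p ≤ v → v < d →
        ∃ c' d', c ≤ c' ∧ c' ≤ u ∧ v ≤ d' ∧ d' ≤ d ∧ γ c' = γ d' := by
      intro u v hcu hup hpv hvd
      obtain ⟨C, hCK, hC⟩ : ∃ C ∈ K, Disjoint (Icc u v) C := by
        have : Nonempty K := hne.to_subtype
        have hempty : Icc u v ∩ ⋂ C : K, (C : Set I) = ∅ := by
          rw [← sInter_eq_iInter, eq_empty_iff_forall_notMem]
          rintro e ⟨⟨h1, h2⟩, he⟩
          rcases hgap e he with h | h
          exacts [(hcu.trans_le h1).not_ge h, (h2.trans_lt hvd).not_ge h]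
        obtain ⟨⟨C, hC⟩, h⟩ := isCompact_Icc.elim_directed_family_closed
          (fun C : K => (C : Set I)) (fun C => (hK C.2).1) hempty
          (fun C C' => (hchain.total C.2 C'.2).elim (fun h => ⟨C, Subset.rfl, h⟩)
            fun h => ⟨C', h, Subset.rfl⟩)
        exact ⟨C, hC, disjoint_iff_inter_eq_empty.2 h⟩
      have hC' := hK hCK
      obtain ⟨c', hc'⟩ := (hC'.1.isCompact.inter_right isClosed_Iic).exists_isGreatest
        ⟨c, hc C hCK, (hcu.le : c ∈ Iic u)⟩
      obtain ⟨d', hd'⟩ := (hC'.1.isCompact.inter_right isClosed_Ici).exists_isLeast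
        ⟨d, hd C hCK, (hvd.le : d ∈ Ici v)⟩
      refine ⟨c', d', hc'.2 ⟨hc C hCK, hcu.le⟩, hc'.1.2, hd'.1.2, hd'.2 ⟨hd C hCK, hvd.le⟩, ?_⟩
      refine hC'.2.2.2 c' hc'.1.1 d' hd'.1.1 ?_ fun e he => ?_
      · refine lt_of_le_of_ne (hc'.1.2.trans (hup.trans (hpv.trans hd'.1.2))) ?_
        rintro rfl
        exact disjoint_left.1 hC ⟨(hup.trans hpv).trans hd'.1.2,
          hc'.1.2.trans (hup.trans hpv)⟩ hc'.1.1
      · by_contra! hcon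
        have h1 : u < e := by
          by_contra! h
          exact hcon.1.not_ge (hc'.2 ⟨he, h⟩)
        have h2 : e < v := by
          by_contra! h
          exact hcon.2.not_ge (hd'.2 ⟨he, h⟩)
        exact disjoint_left.1 hC ⟨h1.le, h2.le⟩ he
    by_contra hγcd
    obtain ⟨U, V, hU, hV, hcU, hdV, hUV⟩ := t2_separation hγcd
    obtain ⟨u₀, hu₀, hu₀U⟩ := exists_Ico_subset_of_mem_nhds
      ((hU.preimage hγ).mem_nhds hcU) ⟨d, hcd⟩
    obtain ⟨v₀, hv₀, hv₀V⟩ := exists_Ioc_subset_of_mem_nhds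
      ((hV.preimage hγ).mem_nhds hdV) ⟨c, hcd⟩
    obtain ⟨u, hcu, hu⟩ := exists_between (lt_min hu₀ hcp)
    obtain ⟨v, hv, hvd⟩ := exists_between (max_lt hv₀ hpd)
    obtain ⟨c', d', h1, h2, h3, h4, h5⟩ := key u v hcu (hu.le.trans (min_le_right _ _))
      ((le_max_right _ _).trans hv.le) hvd
    have hc'U : γ c' ∈ U := hu₀U ⟨h1, h2.trans_lt (hu.trans_le (min_le_left _ _))⟩
    have hd'V : γ d' ∈ V := hv₀V ⟨((le_max_left _ _).trans_lt hv).trans_le h3, h4⟩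
    exact disjoint_left.1 hUV hc'U (h5 ▸ hd'V)
  · exact ⟨isClosed_univ, mem_univ _, mem_univ _, fun c _ d _ hcd h => by
      obtain ⟨p, hcp, hpd⟩ := exists_between hcd
      rcases h p (mem_univ p) with h | h
      exacts [absurd hcp h.not_gt, absurd hpd h.not_gt]⟩

/-- In a metric space, the image of a path with distinct end points contains an arc with
the same end points. -/
lemma exists_arc_of_path {X : Type*} [MetricSpace X] {γ : I → X} (hγ : Continuous γ)
    (hne : γ 0 ≠ γ 1) :
    ∃ α : I → X, Continuous α ∧ Function.Injective α ∧ α 0 = γ 0 ∧ α 1 = γ 1 ∧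
      range α ⊆ range γ := by
  obtain ⟨C, ⟨hCcl, hC0, hC1, hCgap⟩, hmin⟩ := exists_minimal_loopErased hγ
  have hinj : ∀ c ∈ C, ∀ d ∈ C, c < d → γ c = γ d → ∀ e ∈ C, e ≤ c ∨ d ≤ e := by
    intro c hc d hd hcd h e he
    by_contra! hcon
    have hsub : C \ Ioo c d ⊆ C := sdiff_subset
    refine (hmin ⟨hCcl.sdiff isOpen_Ioo, ⟨hC0, fun h => h.1.not_ge nonneg'⟩,
      ⟨hC1, fun h => h.2.not_ge le_one'⟩, ?_⟩ hsub he).2 hcon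
    rintro x ⟨hxC, hx⟩ y ⟨hyC, hy⟩ hxy hgap
    have hc' := hgap c ⟨hc, fun h => h.1.false⟩
    have hd' := hgap d ⟨hd, fun h => h.2.false⟩
    simp only [mem_Ioo, not_and_or, not_lt] at hx hy
    by_cases hxc : x = c ∧ y = d
    · rw [hxc.1, hxc.2, h]
    · refine hCgap x hxC y hyC hxy fun z hz => ?_
      by_cases hz' : z ∈ Ioo c d
      · rcases hc' with h1 | h1
        · rcases hd' with h2 | h2
          · exact Or.inl (hz'.2.le.trans h2)
          · rcases hx with hx | hx
            · rcases hy with hy | hy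
              · exact absurd (hxy.trans_le hy) h1.not_gt
              · exact absurd ⟨hx.antisymm h1, h2.antisymm hy⟩ hxc
            · exact Or.inl (hz'.2.le.trans hx)
        · exact Or.inr (h1.trans hz'.1.le)
      · exact hgap z ⟨hz, hz'⟩
  have hl : ∀ t, ∃ l, IsGreatest (C ∩ Iic t) l := fun t =>
    (hCcl.isCompact.inter_right isClosed_Iic).exists_isGreatest ⟨0, hC0, nonneg'⟩
  have hr : ∀ t, ∃ r, IsLeast (C ∩ Ici t) r := fun t =>
    (hCcl.isCompact.inter_right isClosed_Ici).exists_isLeast ⟨1, hC1, le_one'⟩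
  choose l hl using hl
  choose r hr using hr
  have hlr : ∀ t, γ (l t) = γ (r t) := by
    intro t
    rcases eq_or_lt_of_le ((hl t).1.2.trans (hr t).1.2 : l t ≤ r t) with h | h
    · rw [h]
    · refine hCgap _ (hl t).1.1 _ (hr t).1.1 h fun e he => ?_
      rcases le_total e t with h' | h'
      exacts [Or.inl ((hl t).2 ⟨he, h'⟩), Or.inr ((hr t).2 ⟨he, h'⟩)]
  have hlmono : Monotone l := fun u v huv => (hl v).2 ⟨(hl u).1.1, (hl u).1.2.trans huv⟩
  have hlC : ∀ c ∈ C, l c = c := fun c hc => (hl c).1.2.antisymm ((hl c).2 ⟨hc, self_mem_Iic⟩)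
  have hcont : Continuous (γ ∘ l) := by
    have huc := CompactSpace.uniformContinuous_of_continuous hγ
    refine UniformContinuous.continuous (Metric.uniformContinuous_iff.2 fun ε hε => ?_)
    obtain ⟨δ, hδ, h⟩ := Metric.uniformContinuous_iff.1 huc ε hε
    have key : ∀ s t : I, s ≤ t → dist s t < δ → dist (γ (l s)) (γ (l t)) < ε := by
      intro s t hst hd
      by_cases hls : s ≤ l t
      · have hrl : r s ≤ l t := (hr s).2 ⟨(hl t).1.1, hls⟩
        rw [hlr s]
        refine h (lt_of_le_of_lt ?_ hd)
        have h1 : (s : ℝ) ≤ r s := (hr s).1.2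
        have h2 : (r s : ℝ) ≤ l t := hrl
        have h3 : (l t : ℝ) ≤ t := (hl t).1.2
        rw [Subtype.dist_eq, Subtype.dist_eq, Real.dist_eq, Real.dist_eq, abs_sub_comm,
          abs_of_nonneg (sub_nonneg.2 h2), abs_sub_comm, abs_of_nonneg (by linarith)]
        linarith
      · have : l s = l t := (hlmono hst).antisymm ((hl s).2 ⟨(hl t).1.1, (not_le.1 hls).le⟩)
        simpa [this] using hε
    refine ⟨δ, hδ, fun {s t} hst => ?_⟩
    rcases le_total s t with h' | h'
    · exact key s t h' hst
    · rw [dist_comm] at hst ⊢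
      exact key t s h' hst
  have h0 : (γ ∘ l) 0 = γ 0 := congrArg γ (hlC 0 hC0)
  have h1 : (γ ∘ l) 1 = γ 1 := congrArg γ (hlC 1 hC1)
  have hfib : ∀ u v w, u ≤ w → w ≤ v → (γ ∘ l) u = (γ ∘ l) v → (γ ∘ l) w = (γ ∘ l) u := by
    intro u v w huw hwv huv
    rcases eq_or_lt_of_le (hlmono (huw.trans hwv)) with h | h
    · exact congrArg γ ((h ▸ hlmono hwv).antisymm (hlmono huw))
    · rcases hinj _ (hl u).1.1 _ (hl v).1.1 h huv (l w) (hl w).1.1 with h' | h'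
      · exact congrArg γ (h'.antisymm (hlmono huw))
      · exact (congrArg γ ((hlmono hwv).antisymm h')).trans huv.symm
  obtain ⟨α, hα, hαi, hα0, hα1, hαr⟩ := exists_arc_of_ordConnected_fibers hcont hfib
    (by rwa [h0, h1])
  exact ⟨α, hα, hαi, hα0.trans h0, hα1.trans h1, hαr.trans (range_comp_subset_range _ _)⟩

end Arc

section Circle

/-- Two arcs sharing only their end points form a simple closed curve. -/
lemma exists_circle_of_arcs {X : Type*} [TopologicalSpace X] {A B : I → X}
    (hA : Continuous A) (hB : Continuous B) (hAi : Function.Injective A)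
    (hBi : Function.Injective B) (h0 : A 0 = B 0) (h1 : A 1 = B 1)
    (hAB : ∀ s t, A s = B t → s = 0 ∨ s = 1) :
    ∃ g : Circle → X, Continuous g ∧ Function.Injective g := by
  let F : ℝ → X := fun t =>
    if t ≤ 1 then A (projIcc 0 1 zero_le_one t) else B (projIcc 0 1 zero_le_one (2 - t))
  have hF : Continuous F := by
    refine Continuous.if_le (hA.comp continuous_projIcc)
      (hB.comp (continuous_projIcc.comp (by fun_prop))) continuous_id continuous_const ?_
    rintro _ rfl
    norm_num [projIcc_right]
    exact h1
  have : Fact ((0 : ℝ) < 2) := ⟨two_pos⟩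
  have hFp : F 0 = F 2 := by
    have h2 : ¬ (2 : ℝ) ≤ 1 := by norm_num
    simp only [F, zero_le_one, if_true, h2, if_false, sub_self, projIcc_left]
    exact h0
  have hmix : ∀ s t : ℝ, s ∈ Ico (0 : ℝ) 2 → t ∈ Ico (0 : ℝ) 2 → s ≤ 1 → ¬ t ≤ 1 →
      F s ≠ F t := by
    intro s t hs ht hs1 ht1 h
    have hs' : s ∈ Icc (0 : ℝ) 1 := ⟨hs.1, hs1⟩
    have ht' : 2 - t ∈ Icc (0 : ℝ) 1 := ⟨by linarith [ht.2], by linarith⟩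
    simp only [F, hs1, ht1, if_true, if_false, projIcc_of_mem _ hs', projIcc_of_mem _ ht'] at h
    rcases hAB _ _ h with h' | h'
    · rw [h', h0] at h
      have := congrArg Subtype.val (hBi h)
      simp at this
      linarith [ht.2]
    · rw [h', h1] at h
      have := congrArg Subtype.val (hBi h)
      simp at this
      linarith
  have hinj : InjOn F (Ico 0 2) := by
    intro s hs t ht h
    by_cases hs1 : s ≤ 1 <;> by_cases ht1 : t ≤ 1
    · simp only [F, hs1, ht1, if_true] at h
      exact (strictMonoOn_projIcc (zero_le_one' ℝ)).injOn ⟨hs.1, hs1⟩ ⟨ht.1, ht1⟩ (hAi h)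
    · exact absurd h (hmix s t hs ht hs1 ht1)
    · exact absurd h.symm (hmix t s ht hs ht1 hs1)
    · simp only [F, hs1, ht1, if_false] at h
      have := (strictMonoOn_projIcc (zero_le_one' ℝ)).injOn
        (⟨by linarith [hs.2], by linarith⟩ : 2 - s ∈ Icc (0 : ℝ) 1)
        (⟨by linarith [ht.2], by linarith⟩ : 2 - t ∈ Icc (0 : ℝ) 1) (hBi h)
      linarith
  let e := AddCircle.homeomorphCircle (two_ne_zero : (2 : ℝ) ≠ 0)
  refine ⟨AddCircle.liftIco 2 0 F ∘ e.symm,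
    (AddCircle.liftIco_zero_continuous hFp hF.continuousOn).comp e.symm.continuous,
    Function.Injective.comp ?_ e.symm.injective⟩
  intro x y hxy
  obtain ⟨s, hs, rfl⟩ : ∃ s ∈ Ico (0 : ℝ) 2, (s : AddCircle (2 : ℝ)) = x := by
    have := AddCircle.coe_image_Ico_eq (2 : ℝ) 0
    rw [zero_add] at this
    exact (this ▸ mem_univ x : x ∈ ((↑) : ℝ → AddCircle (2 : ℝ)) '' Ico 0 2)
  obtain ⟨t, ht, rfl⟩ : ∃ s ∈ Ico (0 : ℝ) 2, (s : AddCircle (2 : ℝ)) = y := by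
    have := AddCircle.coe_image_Ico_eq (2 : ℝ) 0
    rw [zero_add] at this
    exact (this ▸ mem_univ y : y ∈ ((↑) : ℝ → AddCircle (2 : ℝ)) '' Ico 0 2)
  rw [AddCircle.liftIco_zero_coe_apply hs, AddCircle.liftIco_zero_coe_apply ht] at hxy
  rw [hinj hs ht hxy]

/-- An arc `A` and a path `B` with the same end points such that `B` misses a point of `A`
give rise to a simple closed curve. -/
lemma exists_circle_of_arc_of_path {X : Type*} [MetricSpace X] {A : I → X}
    (hA : Continuous A) (hAi : Function.Injective A) (B : Path (A 0) (A 1)) {t : I}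
    (ht : A t ∉ range B) : ∃ g : Circle → X, Continuous g ∧ Function.Injective g := by
  have hK : IsClosed (A ⁻¹' range B) := (isCompact_range B.continuous).isClosed.preimage hA
  obtain ⟨u, hu⟩ := (hK.isCompact.inter_right isClosed_Iic).exists_isGreatest
    ⟨0, (⟨0, B.source⟩ : A 0 ∈ range B), (nonneg' : 0 ≤ t)⟩
  obtain ⟨v, hv⟩ := (hK.isCompact.inter_right isClosed_Ici).exists_isLeast
    ⟨1, (⟨1, B.target⟩ : A 1 ∈ range B), (le_one' : t ≤ 1)⟩
  have hut : u < t := lt_of_le_of_ne hu.1.2 (by rintro rfl; exact ht hu.1.1)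
  have htv : t < v := lt_of_le_of_ne hv.1.2 (by rintro rfl; exact ht hv.1.1)
  have huv : (u : ℝ) < v := hut.trans htv
  have hgap : ∀ w, u ≤ w → w ≤ v → A w ∈ range B → w = u ∨ w = v := by
    intro w h1 h2 h3
    rcases le_total w t with h | h
    · exact Or.inl ((hu.2 ⟨h3, h⟩).antisymm h1)
    · exact Or.inr (h2.antisymm (hv.2 ⟨h3, h⟩))
  obtain ⟨p, hp⟩ := hu.1.1
  obtain ⟨q, hq⟩ := hv.1.1
  obtain ⟨β, hβ, hβi, hβ0, hβ1, hβr⟩ := exists_arc_of_path (B.subpath p q).continuous (by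
    rw [Path.source, Path.target, hp, hq]
    exact fun h => huv.ne (congrArg Subtype.val (hAi h)))
  rw [Path.source, hp] at hβ0
  rw [Path.target, hq] at hβ1
  have hβB : range β ⊆ range B := hβr.trans (by
    rw [Path.range_subpath]
    exact image_subset_range _ _)
  let S : I → I := fun s => ⟨u + s * (v - u), by
    have := u.2.1; have := s.2.1; nlinarith, by
    have := v.2.2; have := s.2.2; nlinarith⟩
  have hS : Continuous S := by
    refine Continuous.subtype_mk ?_ _
    fun_prop
  have hS0 : S 0 = u := Subtype.ext (by simp [S])
  have hS1 : S 1 = v := Subtype.ext (by simp [S])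
  have hSi : Function.Injective S := by
    intro x y hxy
    have := congrArg Subtype.val hxy
    simp only [S, add_right_inj] at this
    exact Subtype.ext (mul_right_cancel₀ (sub_pos.2 huv).ne' this)
  refine exists_circle_of_arcs (hA.comp hS) hβ (hAi.comp hSi) hβi
    ((congrArg A hS0).trans hβ0.symm)
    ((congrArg A hS1).trans hβ1.symm) fun s r hsr => ?_
  have huS : u ≤ S s := by
    change (u : ℝ) ≤ u + s * (v - u)
    have := s.2.1
    nlinarith
  have hSv : S s ≤ v := by
    change (u : ℝ) + s * (v - u) ≤ v
    have := s.2.2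
    nlinarith
  rcases hgap (S s) huS hSv (hβB ⟨r, hsr.symm⟩) with h | h
  · exact Or.inl (hSi (h.trans hS0.symm))
  · exact Or.inr (hSi (h.trans hS1.symm))

end Circle

section CutPointOrder

/-- The cut point order with root `e`: every preconnected set containing `e` and `y` also
contains `x`. -/
def CutLE {X : Type*} [TopologicalSpace X] (e x y : X) : Prop :=
  ∀ S : Set X, IsPreconnected S → e ∈ S → y ∈ S → x ∈ S

variable {X : Type*} [MetricSpace X] {e x y z : X}

lemma CutLE.trans (hxy : CutLE e x y) (hyz : CutLE e y z) : CutLE e x z :=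
  fun S hS he hz => hxy S hS he (hyz S hS he hz)

lemma CutLE.refl : CutLE e x x := fun _ _ _ hx => hx

lemma CutLE.root_le : CutLE e e x := fun _ _ he _ => he

lemma exists_path_of_not_cutLE [LocallyPathConnectedSpace X] (h : ¬ CutLE e x y) :
    ∃ γ : Path e y, x ∉ range γ := by
  simp only [CutLE, not_forall] at h
  obtain ⟨S, hS, he, hy, hx⟩ := h
  have hSx : S ⊆ {x}ᶜ := fun s hs h => hx (h ▸ hs)
  have hopen : IsOpen (connectedComponentIn {x}ᶜ e) := isOpen_compl_singleton.connectedComponentIn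
  have hpc := hopen.isConnected_iff_isPathConnected.1
    (isConnected_connectedComponentIn_iff.2 (hSx he))
  have hsub := hS.subset_connectedComponentIn he hSx
  obtain ⟨γ, hγ⟩ := hpc.joinedIn e (hsub he) y (hsub hy)
  refine ⟨γ, ?_⟩
  rintro ⟨t, ht⟩
  exact connectedComponentIn_subset _ _ (hγ t) ht

lemma isClosed_cutLE [LocallyPathConnectedSpace X] :
    IsClosed {p : X × X | CutLE e p.1 p.2} := by
  rw [← isOpen_compl_iff, isOpen_iff_mem_nhds]
  rintro ⟨x, y⟩ h
  obtain ⟨γ, hγ⟩ := exists_path_of_not_cutLE h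
  have hxy : x ≠ y := by
    rintro rfl
    exact hγ ⟨1, γ.target⟩
  obtain ⟨U, V, hU, hV, hxU, hyV, hUV⟩ := t2_separation hxy
  obtain ⟨V', ⟨hV'o, hyV', hV'⟩, hV'V⟩ :=
    (isOpen_isPathConnected_basis y).mem_iff.1 (hV.mem_nhds hyV)
  have hK : (range γ)ᶜ ∈ 𝓝 x := (isCompact_range γ.continuous).isClosed.isOpen_compl.mem_nhds hγ
  filter_upwards [prod_mem_nhds (inter_mem (hU.mem_nhds hxU) hK) (hV'o.mem_nhds hyV')]
  rintro ⟨x', y'⟩ ⟨⟨hx'U, hx'γ⟩, hy'⟩ hle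
  have hS : IsPreconnected (range γ ∪ V') :=
    (isPreconnected_range γ.continuous).union y ⟨1, γ.target⟩ hyV' hV'.isConnected.isPreconnected
  rcases hle _ hS (Or.inl ⟨0, γ.source⟩) (Or.inr hy') with h | h
  · exact hx'γ h
  · exact disjoint_left.1 hUV hx'U (hV'V h)

lemma CutLE.antisymm [PathConnectedSpace X] (hxy : CutLE e x y) (hyx : CutLE e y x) :
    x = y := by
  let γ := PathConnectedSpace.somePath e y
  have hcl : IsClosed (γ ⁻¹' {x, y}) := (toFinite {x, y}).isClosed.preimage γ.continuous
  obtain ⟨t, ht, hmin⟩ := hcl.isCompact.exists_isLeast ⟨1, by simp⟩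
  have hpre : IsPreconnected (γ '' Icc 0 t) := isPreconnected_Icc.image _ γ.continuous.continuousOn
  have he : e ∈ γ '' Icc 0 t := ⟨0, ⟨le_rfl, nonneg'⟩, γ.source⟩
  have ht' : γ t ∈ γ '' Icc 0 t := ⟨t, ⟨nonneg', le_rfl⟩, rfl⟩
  rcases ht with h | h <;> rw [h] at ht'
  · obtain ⟨s, hs, hsy⟩ := hyx _ hpre he ht'
    have hst : s = t := hs.2.antisymm (hmin (Or.inr hsy))
    rw [← hsy, hst, h]
  · obtain ⟨s, hs, hsx⟩ := hxy _ hpre he ht'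
    have hst : s = t := hs.2.antisymm (hmin (Or.inl hsx))
    rw [← hsx, hst, h]

/-- Among the points moved away from the root by `f` there is a maximal one. -/
lemma exists_maximal_cutLE_apply [CompactSpace X] [PathConnectedSpace X]
    [LocallyPathConnectedSpace X] (e : X) {f : X → X} (hf : Continuous f) :
    ∃ m, CutLE e m (f m) ∧ ∀ x, CutLE e x (f x) → CutLE e m x → x = m := by
  let P := {x : X // CutLE e x (f x)}
  let r : P → P → Prop := fun x y => CutLE e x.1 y.1
  have hbdd : ∀ c : Set P, IsChain r c → ∃ ub, ∀ a ∈ c, r a ub := by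
    intro c hc
    rcases c.eq_empty_or_nonempty with rfl | hne
    · exact ⟨⟨e, CutLE.root_le⟩, by simp⟩
    · have : Nonempty c := hne.to_subtype
      let K : c → Set X := fun x => {y | CutLE e y (f y) ∧ CutLE e x.1.1 y}
      have hKc : ∀ i, IsClosed (K i) := fun i =>
        (isClosed_cutLE.preimage (continuous_id.prodMk hf)).inter
          (isClosed_cutLE.preimage (continuous_const.prodMk continuous_id))
      obtain ⟨y, hy⟩ := IsCompact.nonempty_iInter_of_directed_nonempty_isCompact_isClosed K
        (fun i j => by
          have : r i.1 j.1 ∨ r j.1 i.1 := by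
            by_cases hij : i.1 = j.1
            · exact Or.inl (by rw [hij]; exact CutLE.refl)
            · exact hc i.2 j.2 hij
          rcases this with h | h
          · exact ⟨j, fun y hy => ⟨hy.1, h.trans hy.2⟩, Subset.rfl⟩
          · exact ⟨i, Subset.rfl, fun y hy => ⟨hy.1, h.trans hy.2⟩⟩)
        (fun i => ⟨i.1.1, i.1.2, CutLE.refl⟩) (fun i => (hKc i).isCompact) hKc
      rw [mem_iInter] at hy
      exact ⟨⟨y, (hy ⟨_, hne.some_mem⟩).1⟩, fun a ha => (hy ⟨a, ha⟩).2⟩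
  obtain ⟨m, hm⟩ := exists_maximal_of_chains_bounded hbdd fun h h' => CutLE.trans h h'
  exact ⟨m.1, m.2, fun x hx hmx => (hm ⟨x, hx⟩ hmx).antisymm hmx⟩

end CutPointOrder

/-- A dendrite: a locally connected metric continuum containing no simple closed
curve (no continuous injective image of the circle). Every continuous self-map of
a dendrite has a fixed point. -/
theorem dendrite_fixed_point {D : Type*} [MetricSpace D] [CompactSpace D]
    [ConnectedSpace D] [LocallyConnectedSpace D] [Nonempty D]
    (hnoscc : ∀ g : Circle → D, Continuous g → ¬ Function.Injective g)
    (f : D → D) (hf : Continuous f) :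
    ∃ x : D, f x = x := by
  have : LocallyPathConnectedSpace D := locallyPathConnectedSpace_of_compactSpace
  have : PathConnectedSpace D := .of_locallyPathConnectedSpace
  obtain ⟨e⟩ := ‹Nonempty D›
  obtain ⟨m, hm, hmax⟩ := exists_maximal_cutLE_apply e hf
  refine ⟨m, ?_⟩
  by_contra hne
  let γ := PathConnectedSpace.somePath m (f m)
  obtain ⟨A, hA, hAi, hA0, hA1, -⟩ := exists_arc_of_path γ.continuous (by
    rw [γ.source, γ.target]
    exact fun h => hne h.symm)
  rw [γ.source] at hA0
  rw [γ.target] at hA1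
  obtain ⟨O, V, hO, hV, hmO, hfV, hOV⟩ := t2_separation (fun h => hne h.symm : m ≠ f m)
  obtain ⟨W, ⟨hWo, hfW, hW⟩, hWV⟩ :=
    (isOpen_isPathConnected_basis (f m)).mem_iff.1 (hV.mem_nhds hfV)
  obtain ⟨t, ht0, htO, htW⟩ : ∃ t : I, 0 < t ∧ A t ∈ O ∧ f (A t) ∈ W := by
    have h1 : ∀ᶠ t in 𝓝[>] (0 : I), A t ∈ O :=
      mem_nhdsWithin_of_mem_nhds ((hO.preimage hA).mem_nhds (by simpa [hA0] using hmO))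
    have h2 : ∀ᶠ t in 𝓝[>] (0 : I), f (A t) ∈ W :=
      mem_nhdsWithin_of_mem_nhds ((hWo.preimage (hf.comp hA)).mem_nhds (by simpa [hA0] using hfW))
    have h3 : ∀ᶠ t in 𝓝[>] (0 : I), 0 < t := self_mem_nhdsWithin
    have : (𝓝[>] (0 : I)).NeBot := nhdsGT_neBot_of_exists_gt ⟨1, zero_lt_one⟩
    exact (h3.and (h1.and h2)).exists
  have hmt : CutLE e m (A t) := by
    intro S hS he hS'
    rcases hm (S ∪ A '' Icc t 1) (hS.union (A t) hS' ⟨t, ⟨le_rfl, le_one'⟩, rfl⟩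
      (isPreconnected_Icc.image _ hA.continuousOn)) (Or.inl he)
      (Or.inr ⟨1, ⟨le_one', le_rfl⟩, hA1⟩) with h | ⟨s, hs, hsm⟩
    · exact h
    · exact absurd (hAi (hsm.trans hA0.symm)) (ht0.trans_le hs.1).ne'
  have htf : CutLE e (A t) (f m) := by
    by_contra h
    obtain ⟨β, hβ⟩ := exists_path_of_not_cutLE h
    obtain ⟨p, hp⟩ := hm _ (isPreconnected_range β.continuous) ⟨0, β.source⟩ ⟨1, β.target⟩
    obtain ⟨g, hg, hgi⟩ := exists_circle_of_arc_of_path hA hAi (t := t)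
      ((β.subpath p 1).cast (hA0.trans hp.symm) (hA1.trans β.target.symm)) (by
        rw [Path.cast_coe, Path.range_subpath]
        exact fun h => hβ (image_subset_range _ _ h))
    exact hnoscc g hg hgi
  have htft : CutLE e (A t) (f (A t)) := by
    intro S hS he hS'
    rcases htf (S ∪ W) (hS.union _ hS' htW hW.isConnected.isPreconnected) (Or.inl he)
      (Or.inr hfW) with h | h
    · exact h
    · exact absurd (hWV h) (disjoint_left.1 hOV htO)
  exact ht0.ne' (hAi ((hmax _ htft hmt).trans hA0.symm))
end

section
/- Let D₁ ⊆ D₂ be dendrites, f : D₁ → D₂ continuous, and suppose there exist two distinct points e₁ ≠ e₂ of D₁ such that for each i, eᵢ separates f(eᵢ) from e_{3-i} in D₂ (i.e., eᵢ lies in the open arc from e_{3-i} to f(eᵢ)). Then f has a fixed point c in the open arc (e₁, e₂) of D₂. -/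
/-- `D` is a dendrite (as a subspace of the metric space `X`): a locally connected
metric continuum containing no simple closed curve. -/
def IsDendrite {X : Type*} [MetricSpace X] (D : Set X) : Prop :=
  D.Nonempty ∧ IsCompact D ∧ IsConnected D ∧ LocallyConnectedSpace D ∧
    ∀ g : Circle → X, Continuous g → Set.range g ⊆ D → ¬ Function.Injective g

/-- `x` separates `y` from `z` in `D`: `y` and `z` lie in different connected
components of `D \ {x}`. -/
def SeparatesIn {X : Type*} [MetricSpace X] (D : Set X) (x y z : X) : Prop :=
  y ∈ D \ {x} ∧ z ∈ D \ {x} ∧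
    connectedComponentIn (D \ {x}) y ≠ connectedComponentIn (D \ {x}) z

open Set Filter Topology

/-- `y` is reached from `x` in at most `N` jumps of length less than `δ` inside `C`. -/
def ChainJoined {Y : Type*} [PseudoMetricSpace Y] (C : Set Y) (δ : ℝ) (N : ℕ) (x y : Y) : Prop :=
  ∃ z : ℕ → Y, z 0 = x ∧ (∀ i, N ≤ i → z i = y) ∧ (∀ i, z i ∈ C) ∧
    ∀ i, dist (z i) (z (i + 1)) < δ

namespace ChainJoined

variable {Y : Type*} [PseudoMetricSpace Y] {C C' : Set Y} {δ : ℝ} {M N : ℕ} {x y w : Y}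

lemma mono (h : ChainJoined C δ N x y) (hC : C ⊆ C') (hNM : N ≤ M) : ChainJoined C' δ M x y := by
  obtain ⟨z, h0, h1, h2, h3⟩ := h
  exact ⟨z, h0, fun i hi => h1 i (hNM.trans hi), fun i => hC (h2 i), h3⟩

lemma single (hx : x ∈ C) (hy : y ∈ C) (h : dist x y < δ) : ChainJoined C δ 1 x y := by
  have hδ : 0 < δ := dist_nonneg.trans_lt h
  refine ⟨fun i => if i = 0 then x else y, by simp, fun i hi => ?_, fun i => ?_, fun i => ?_⟩
  · simp [Nat.one_le_iff_ne_zero.mp hi]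
  · dsimp only; split_ifs <;> assumption
  · rcases i with _ | i <;> simp [h, hδ]

lemma trans (h : ChainJoined C δ N x y) (h' : ChainJoined C δ M y w) :
    ChainJoined C δ (N + M) x w := by
  obtain ⟨z, h0, h1, h2, h3⟩ := h
  obtain ⟨z', h0', h1', h2', h3'⟩ := h'
  refine ⟨fun i => if i < N then z i else z' (i - N), ?_, fun i hi => ?_, fun i => ?_,
    fun i => ?_⟩
  · rcases Nat.eq_zero_or_pos N with rfl | hN
    · simp [h0', ← h0, h1 0 le_rfl]
    · simp [hN, h0]
  · have : ¬ i < N := by omega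
    simp only [this, if_false]
    exact h1' _ (by omega)
  · dsimp only; split_ifs
    exacts [h2 i, h2' _]
  · by_cases hi : i + 1 < N
    · have : i < N := by omega
      simp [hi, this, h3]
    · by_cases hi' : i < N
      · have hN : i + 1 = N := by omega
        have := h3 i
        rw [h1 (i + 1) hN.ge] at this
        simpa [hi', hi, hN, h0'] using this
      · have e : i + 1 - N = (i - N) + 1 := by omega
        simp [hi', hi, e, h3']

end ChainJoined

lemma IsPreconnected.exists_chainJoined {Y : Type*} [PseudoMetricSpace Y] {C : Set Y}
    (hC : IsPreconnected C) {δ : ℝ} (hδ : 0 < δ) {x y : Y} (hx : x ∈ C) (hy : y ∈ C) :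
    ∃ N, ChainJoined C δ N x y := by
  refine hC.induction₂' (fun x y => ∃ N, ChainJoined C δ N x y) (fun x hx => ?_)
    (fun x y z _ _ _ ⟨N, h⟩ ⟨M, h'⟩ => ⟨N + M, h.trans h'⟩) hx hy
  filter_upwards [self_mem_nhdsWithin, mem_nhdsWithin_of_mem_nhds (Metric.ball_mem_nhds x hδ)]
    with y hy hxy
  exact ⟨⟨1, .single hx hy (by rwa [dist_comm])⟩, ⟨1, .single hy hx hxy⟩⟩

lemma IsPreconnected.exists_uniform_chainJoined {Y : Type*} [PseudoMetricSpace Y] {C : Set Y}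
    (hC : IsPreconnected C) (hC' : TotallyBounded C) {δ : ℝ} (hδ : 0 < δ) :
    ∃ N, ∀ x ∈ C, ∀ y ∈ C, ChainJoined C δ N x y := by
  obtain ⟨t, htC, htf, ht⟩ := hC'.exists_subset (Metric.dist_mem_uniformity hδ)
  have key : ∀ p : Y × Y, ∃ N, p ∈ t ×ˢ t → ChainJoined C δ N p.1 p.2 := by
    intro p
    by_cases hp : p ∈ t ×ˢ t
    · obtain ⟨N, hN⟩ := hC.exists_chainJoined hδ (htC hp.1) (htC hp.2)
      exact ⟨N, fun _ => hN⟩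
    · exact ⟨0, fun h => absurd h hp⟩
  choose N hN using key
  obtain ⟨M, hM⟩ := ((htf.prod htf).image N).bddAbove
  refine ⟨1 + M + 1, fun x hx y hy => ?_⟩
  obtain ⟨a, ha, hxa⟩ := mem_iUnion₂.mp (ht hx)
  obtain ⟨b, hb, hyb⟩ := mem_iUnion₂.mp (ht hy)
  have hab : (a, b) ∈ t ×ˢ t := ⟨ha, hb⟩
  refine ((ChainJoined.single hx (htC ha) hxa).trans
    ((hN (a, b) hab).mono subset_rfl (hM (mem_image_of_mem N hab)))).trans
    (ChainJoined.single (htC hb) hy ?_)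
  rw [dist_comm]
  exact hyb

lemma exists_uniform_chainJoined_ball {Y : Type*} [PseudoMetricSpace Y] [CompactSpace Y]
    [LocallyConnectedSpace Y] {ε : ℝ} (hε : 0 < ε) :
    ∃ δ > 0, δ ≤ ε ∧ ∀ δ' > 0, ∃ N > 0, ∀ x y : Y, dist x y < δ →
      ChainJoined (Metric.ball x ε) δ' N x y := by
  have H : ∀ p : Y, ∃ V ⊆ Metric.ball p (ε / 2), IsOpen V ∧ p ∈ V ∧ IsConnected V := fun p =>
    locallyConnectedSpace_iff_subsets_isOpen_isConnected.mp ‹_› p _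
      (Metric.ball_mem_nhds p (half_pos hε))
  choose V hVb hVo hVp hVc using H
  obtain ⟨t, ht⟩ := isCompact_univ.elim_finite_subcover V hVo
    (fun p _ => mem_iUnion.mpr ⟨p, hVp p⟩)
  obtain ⟨δ, hδ, hδt⟩ := lebesgue_number_lemma_of_metric (c := fun p : t => V p)
    (isCompact_univ (X := Y)) (fun p => hVo p) (by simpa [iUnion_subtype] using ht)
  refine ⟨min δ ε, lt_min hδ hε, min_le_right _ _, fun δ' hδ' => ?_⟩
  choose N hN using fun p : Y => (hVc p).isPreconnected.exists_uniform_chainJoined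
    (isCompact_univ.totallyBounded.subset (subset_univ _)) hδ'
  refine ⟨t.sup N + 1, by omega, fun x y hxy => ?_⟩
  obtain ⟨p, hp⟩ := hδt x (mem_univ _)
  have hx := hp (Metric.mem_ball_self hδ)
  have hy := hp (Metric.mem_ball'.mpr (hxy.trans_le (min_le_left _ _)))
  refine (hN p x hx y hy).mono (fun z hz => ?_) ((Finset.le_sup p.2).trans (Nat.le_succ _))
  have h1 := Metric.mem_ball.mp (hVb p hz)
  have h2 := Metric.mem_ball.mp (hVb p hx)
  rw [Metric.mem_ball]
  linarith [dist_triangle_right z x (p : Y)]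

/-- Points close to each other in a compact locally connected metric space are joined by a short
path. -/
lemma exists_joinedIn_closedBall {Y : Type*} [MetricSpace Y] [CompactSpace Y]
    [LocallyConnectedSpace Y] {r : ℝ} (hr : 0 < r) :
    ∃ δ > 0, ∀ x y : Y, dist x y < δ → JoinedIn (Metric.closedBall x (2 * r)) x y := by
  have hE : ∀ n : ℕ, 0 < r / 2 / 2 ^ n := fun n => by positivity
  choose d hd hdE hdN using fun n => exists_uniform_chainJoined_ball (Y := Y) (hE n)
  choose N hN0 hN using fun n => hdN n (d (n + 1)) (hd (n + 1))
  choose c hc0 hcN hcb hcd using hN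
  refine ⟨d 0, hd 0, fun x y hxy => ?_⟩
  classical
  let c' : ℕ → Y → Y → ℕ → Y := fun n a b k => if h : dist a b < d n then c n a b h k else a
  let p : ℕ → ℕ → Y := fun n => Nat.rec (fun i => if i = 0 then x else y)
    (fun n q k => c' n (q (k / N n)) (q (k / N n + 1)) (k % N n)) n
  have hps : ∀ n k, p (n + 1) k = c' n (p n (k / N n)) (p n (k / N n + 1)) (k % N n) :=
    fun n k => rfl
  have hp : ∀ n i, dist (p n i) (p n (i + 1)) < d n := by
    intro n
    induction n with
    | zero =>
      intro i
      rcases i with _ | i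
      · simpa [p] using hxy
      · simpa [p] using hd 0
    | succ n ih =>
      intro k
      rw [hps, hps]
      rcases (Nat.succ_le_of_lt (Nat.mod_lt k (hN0 n))).lt_or_eq with h | h
      · have e2 : (k + 1) % N n = k % N n + 1 := by
          rw [Nat.add_mod, Nat.mod_eq_of_lt (a := 1) (by omega), Nat.mod_eq_of_lt h]
        have e1 : (k + 1) / N n = k / N n := by
          rw [Nat.add_div (hN0 n), Nat.mod_eq_of_lt (a := 1) (by omega),
            Nat.div_eq_of_lt (a := 1) (by omega), if_neg (by omega), add_zero, add_zero]
        rw [e1, e2]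
        simp only [c', dif_pos (ih _)]
        exact hcd _ _ _ _ _
      · have hk : k + 1 = N n * (k / N n + 1) := by
          have := Nat.div_add_mod k (N n)
          rw [mul_add, mul_one]; omega
        have e1 : (k + 1) / N n = k / N n + 1 := by
          rw [hk, Nat.mul_div_cancel_left _ (hN0 n)]
        have e2 : (k + 1) % N n = 0 := by rw [hk, Nat.mul_mod_right]
        rw [e1, e2]
        simp only [c', dif_pos (ih _)]
        have := hcd n _ _ (ih (k / N n)) (k % N n)
        rw [hcN n _ _ (ih (k / N n)) (k % N n + 1) h.ge] at this
        rwa [hc0]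
  let M : ℕ → ℕ := fun n => ∏ i ∈ Finset.range n, N i
  have hM0 : ∀ n, 0 < M n := fun n => Finset.prod_pos fun i _ => hN0 i
  have hMs : ∀ n, M (n + 1) = M n * N n := fun n => Finset.prod_range_succ _ _
  let f : ℕ → ℝ → Y := fun n t => p n ⌊t * M n⌋₊
  have hfs : ∀ t n, dist (f n t) (f (n + 1) t) ≤ r / 2 / 2 ^ n := by
    intro t n
    have e : ⌊t * M (n + 1)⌋₊ / N n = ⌊t * M n⌋₊ := by
      rw [← Nat.floor_div_natCast, hMs]
      have : (N n : ℝ) ≠ 0 := by exact_mod_cast (hN0 n).ne'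
      congr 1
      push_cast
      field_simp
    simp only [f, hps, e, c', dif_pos (hp _ _)]
    rw [dist_comm]
    exact (Metric.mem_ball.mp (hcb _ _ _ _ _)).le
  choose g hg using fun t => cauchySeq_tendsto_of_complete (cauchySeq_of_le_geometric_two (hfs t))
  have hfg : ∀ t n, dist (f n t) (g t) ≤ r / 2 ^ n := fun t n =>
    dist_le_of_le_geometric_two_of_tendsto (hfs t) (hg t) n
  have hf1 : ∀ n, p n (M n) = y := by
    intro n
    induction n with
    | zero => simp [p, M]
    | succ n ih =>
      rw [hps, hMs, Nat.mul_div_cancel _ (hN0 n), Nat.mul_mod_left]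
      simp only [c', dif_pos (hp _ _)]
      rw [hc0, ih]
  have hf0 : ∀ n, p n 0 = x := by
    intro n
    induction n with
    | zero => simp [p]
    | succ n ih =>
      rw [hps, Nat.zero_div, Nat.zero_mod]
      simp only [c', dif_pos (hp _ _)]
      rw [hc0, ih]
  have hg0 : g 0 = x := by
    refine tendsto_nhds_unique (hg 0) ?_
    simp [f, hf0]
  have hg1 : g 1 = y := by
    refine tendsto_nhds_unique (hg 1) ?_
    simp [f, hf1]
  have hlim : Tendsto (fun n : ℕ => r / 2 ^ n) atTop (𝓝 0) := by
    simpa [div_eq_mul_inv] using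
      (tendsto_pow_atTop_nhds_zero_of_lt_one (r := (2 : ℝ)⁻¹) (by norm_num)
        (by norm_num)).const_mul r
  have hcont : Continuous g := by
    rw [Metric.continuous_iff']
    intro t ε hε
    obtain ⟨n, hn⟩ := (hlim.eventually (gt_mem_nhds (show 0 < ε / 4 by linarith))).exists
    have hMn : (0 : ℝ) < M n := by exact_mod_cast hM0 n
    have hnear : ∀ᶠ s in 𝓝 t, dist s t < 1 / M n :=
      Metric.ball_mem_nhds t (by positivity)
    filter_upwards [hnear] with s hs
    have step : ∀ s t : ℝ, s ≤ t → dist s t < 1 / M n → dist (f n s) (f n t) < ε / 4 := by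
      intro s t hst h
      rw [dist_comm, Real.dist_eq, abs_of_nonneg (by linarith), lt_div_iff₀ hMn] at h
      have l1 : ⌊s * M n⌋₊ ≤ ⌊t * M n⌋₊ := Nat.floor_mono (by gcongr)
      have l2 : ⌊t * M n⌋₊ ≤ ⌊s * M n⌋₊ + 1 := by
        have hlt : t * M n < ((⌊s * M n⌋₊ + 1 + 1 : ℕ) : ℝ) := by
          push_cast
          linarith [Nat.lt_floor_add_one (s * M n)]
        have := (Nat.floor_lt' (n := ⌊s * M n⌋₊ + 1 + 1) (by omega)).mpr hlt
        omega
      have hdn : d n < ε / 4 := by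
        refine (hdE n).trans_lt (lt_of_le_of_lt ?_ hn)
        gcongr
        linarith
      simp only [f]
      rcases (show ⌊t * M n⌋₊ = ⌊s * M n⌋₊ ∨ ⌊t * M n⌋₊ = ⌊s * M n⌋₊ + 1 by omega) with h | h
      · rw [h, dist_self]; linarith
      · rw [h]; exact (hp n _).trans hdn
    have hst : dist (f n s) (f n t) < ε / 4 := by
      rcases le_total s t with h | h
      · exact step s t h hs
      · rw [dist_comm]; rw [dist_comm] at hs; exact step t s h hs
    have h1 := hfg s n
    have h2 := hfg t n
    have h3 := dist_triangle4 (g s) (f n s) (f n t) (g t)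
    rw [dist_comm (g s) (f n s)] at h3
    linarith
  refine ⟨⟨⟨fun t => g t, by fun_prop⟩, by simpa using hg0, by simpa using hg1⟩, fun t => ?_⟩
  change g t ∈ _
  rw [Metric.mem_closedBall, dist_comm]
  by_cases ht : (t : ℝ) = 1
  · rw [ht, hg1]
    have := hdE 0
    simp only [pow_zero, div_one] at this
    linarith
  · have hft : f 0 t = x := by
      have : (t : ℝ) < 1 := lt_of_le_of_ne t.2.2 ht
      have h0 : ⌊(t : ℝ)⌋₊ = 0 := Nat.floor_eq_zero.mpr this
      simp [f, p, M, h0]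
    have := hfg t 0
    rw [hft] at this
    simp only [pow_zero, div_one] at this
    linarith

/-- A compact locally connected metric space is locally path connected. -/
lemma LocallyConnectedSpace.locallyPathConnectedSpace (Y : Type*) [MetricSpace Y] [CompactSpace Y]
    [LocallyConnectedSpace Y] : LocallyPathConnectedSpace Y := by
  rw [locallyPathConnectedSpace_iff_pathComponentIn_mem_nhds]
  intro x u hu hx
  obtain ⟨ε, hε, hεu⟩ := Metric.isOpen_iff.mp hu x hx
  obtain ⟨δ, hδ, h⟩ := exists_joinedIn_closedBall (Y := Y) (show 0 < ε / 4 by linarith)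
  refine mem_of_superset (Metric.ball_mem_nhds x hδ) fun y hy => ?_
  exact (h x y (Metric.mem_ball'.mp hy)).mono
    ((Metric.closedBall_subset_ball (by linarith)).trans hεu)

/-- A path in a Hausdorff space can be restricted to a closed set of times whose only coincidences
are those of the two ends of a complementary gap. -/
lemma exists_closed_times_of_continuous {X : Type*} [TopologicalSpace X] [T2Space X] {γ : ℝ → X}
    (hγ : Continuous γ) :
    ∃ K ⊆ Icc (0 : ℝ) 1, IsClosed K ∧ 0 ∈ K ∧ 1 ∈ K ∧
      ∀ s ∈ K, ∀ u ∈ K, s < u → (γ s = γ u ↔ ∀ x ∈ Ioo s u, x ∉ K) := by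
  let S : Set (Set ℝ) := {K | K ⊆ Icc 0 1 ∧ IsClosed K ∧ 0 ∈ K ∧ 1 ∈ K ∧
    ∀ s ∈ K, ∀ u ∈ K, s < u → (∀ x ∈ Ioo s u, x ∉ K) → γ s = γ u}
  have hI : Icc (0 : ℝ) 1 ∈ S := by
    refine ⟨subset_rfl, isClosed_Icc, by simp, by simp, fun s hs u hu hsu h => ?_⟩
    exact absurd ⟨by linarith [hs.1, hu.1], by linarith [hs.2, hu.2]⟩
      (h ((s + u) / 2) ⟨by linarith, by linarith⟩)
  have hchain : ∀ c ⊆ S, IsChain (· ⊆ ·) c → c.Nonempty → ∃ lb ∈ S, ∀ s ∈ c, lb ⊆ s := by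
    intro c hcS hc hne
    refine ⟨⋂₀ c, ⟨?_, isClosed_sInter fun K hK => (hcS hK).2.1, fun K hK => (hcS hK).2.2.1,
      fun K hK => (hcS hK).2.2.2.1, fun s hs u hu hsu h => ?_⟩, fun K hK => sInter_subset_of_mem hK⟩
    · obtain ⟨K, hK⟩ := hne
      exact (sInter_subset_of_mem hK).trans (hcS hK).1
    by_contra hne'
    have hopen : IsOpen {p : ℝ × ℝ | γ p.1 ≠ γ p.2} := isOpen_ne_fun (by fun_prop) (by fun_prop)
    obtain ⟨ε, hε, hball⟩ := Metric.isOpen_iff.mp hopen (s, u) hne'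
    obtain ⟨η, hη, hηε, hηu⟩ : ∃ η > 0, η < ε ∧ s + η < u - η :=
      ⟨min (ε / 2) ((u - s) / 3), lt_min (by linarith) (by linarith),
        (min_le_left _ _).trans_lt (by linarith),
        by linarith [min_le_right (ε / 2) ((u - s) / 3)]⟩
    have : Nonempty c := hne.to_subtype
    obtain ⟨⟨K, hKc⟩, hK⟩ := (isCompact_Icc (a := s + η) (b := u - η)).elim_directed_family_closed
      (fun K : c => (K : Set ℝ)) (fun K => (hcS K.2).2.1)
      (by
        rw [← sInter_eq_iInter, eq_empty_iff_forall_notMem]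
        rintro x ⟨hx, hxc⟩
        exact h x ⟨by linarith [hx.1], by linarith [hx.2]⟩ hxc)
      (by
        intro A B
        rcases hc.total A.2 B.2 with h | h
        · exact ⟨A, subset_rfl, h⟩
        · exact ⟨B, h, subset_rfl⟩)
    obtain ⟨hK01, hKcl, h0, h1, hgap⟩ := hcS hKc
    have hcomp : IsCompact K := isCompact_Icc.of_isClosed_subset hKcl hK01
    obtain ⟨s', hs'⟩ := (hcomp.inter_right (isClosed_Iic (a := s + η))).exists_isGreatest
      ⟨s, hs K hKc, by simp [hη.le]⟩
    obtain ⟨u', hu'⟩ := (hcomp.inter_right (isClosed_Ici (a := u - η))).exists_isLeast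
      ⟨u, hu K hKc, by simp [hη.le]⟩
    have hss' : s ≤ s' := hs'.2 ⟨hs K hKc, by simp [hη.le]⟩
    have huu' : u' ≤ u := hu'.2 ⟨hu K hKc, by simp [hη.le]⟩
    have hs'η : s' ≤ s + η := hs'.1.2
    have hu'η : u - η ≤ u' := hu'.1.2
    refine hball (a := (s', u')) ?_ (hgap s' hs'.1.1 u' hu'.1.1 (by linarith) fun x hx hxK => ?_)
    · rw [Metric.mem_ball, Prod.dist_eq, max_lt_iff, Real.dist_eq, Real.dist_eq, abs_lt, abs_lt]
      refine ⟨⟨?_, ?_⟩, ?_, ?_⟩ <;> dsimp only <;> linarith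
    · rcases le_or_gt x (s + η) with hx1 | hx1
      · exact absurd (hs'.2 ⟨hxK, hx1⟩) (not_le.mpr hx.1)
      rcases le_or_gt (u - η) x with hx2 | hx2
      · exact absurd (hu'.2 ⟨hxK, hx2⟩) (not_le.mpr hx.2)
      exact (eq_empty_iff_forall_notMem.mp hK) x ⟨⟨hx1.le, hx2.le⟩, hxK⟩
  obtain ⟨K, -, hK⟩ := zorn_superset_nonempty S hchain _ hI
  obtain ⟨hK01, hKc, h0, h1, hgap⟩ := hK.prop
  refine ⟨K, hK01, hKc, h0, h1, fun s hs u hu hsu => ⟨fun hsu' x hx hxK => ?_, hgap s hs u hu hsu⟩⟩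
  have hmem : K \ Ioo s u ∈ S := by
    refine ⟨sdiff_subset.trans hK01, hKc.sdiff isOpen_Ioo,
      ⟨h0, fun h => absurd h.1 (not_lt.mpr (hK01 hs).1)⟩,
      ⟨h1, fun h => absurd h.2 (not_lt.mpr (hK01 hu).2)⟩, fun p hp q hq hpq h => ?_⟩
    by_cases hx : ∃ y ∈ Ioo p q, y ∈ K
    · obtain ⟨y, hy, hyK⟩ := hx
      have hy' : y ∈ Ioo s u := by
        by_contra hy'
        exact h y hy ⟨hyK, hy'⟩
      have hps : p ≤ s := by
        by_contra! hlt
        exact hp.2 ⟨hlt, hy.1.trans hy'.2⟩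
      have huq : u ≤ q := by
        by_contra! hlt
        exact hq.2 ⟨hy'.1.trans hy.2, hlt⟩
      have hps' : p = s := by
        by_contra hne
        exact h s ⟨lt_of_le_of_ne hps hne, hy'.1.trans hy.2⟩ ⟨hs, fun h => lt_irrefl _ h.1⟩
      have huq' : u = q := by
        by_contra hne
        exact h u ⟨hy.1.trans hy'.2, lt_of_le_of_ne huq hne⟩ ⟨hu, fun h => lt_irrefl _ h.2⟩
      rw [hps', ← huq', hsu']
    · push Not at hx
      exact hgap p hp.1 q hq.1 hpq hx
  exact (hK.le_of_le hmem sdiff_subset hxK).2 hx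

/-- Every path can be replaced by one which is constant between any two times at which it takes
the same value. -/
lemma exists_monotone_path {X : Type*} [MetricSpace X] {γ : ℝ → X} (hγ : Continuous γ) :
    ∃ η : ℝ → X, ContinuousOn η (Icc 0 1) ∧ η 0 = γ 0 ∧ η 1 = γ 1 ∧
      MapsTo η (Icc 0 1) (γ '' Icc 0 1) ∧
      ∀ s ∈ Icc (0 : ℝ) 1, ∀ t ∈ Icc (0 : ℝ) 1, η s = η t → ∀ x ∈ Icc s t, η x = η s := by
  obtain ⟨K, hK01, hKc, h0, h1, hgap⟩ := exists_closed_times_of_continuous hγ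
  have hcomp : IsCompact K := isCompact_Icc.of_isClosed_subset hKc hK01
  have hρ : ∀ t : ℝ, ∃ s, t ∈ Icc 0 1 → IsGreatest (K ∩ Iic t) s := fun t => by
    by_cases ht : t ∈ Icc (0 : ℝ) 1
    · obtain ⟨s, hs⟩ := (hcomp.inter_right (isClosed_Iic (a := t))).exists_isGreatest
        ⟨0, h0, ht.1⟩
      exact ⟨s, fun _ => hs⟩
    · exact ⟨0, fun h => absurd h ht⟩
  have hσ : ∀ t : ℝ, ∃ s, t ∈ Icc 0 1 → IsLeast (K ∩ Ici t) s := fun t => by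
    by_cases ht : t ∈ Icc (0 : ℝ) 1
    · obtain ⟨s, hs⟩ := (hcomp.inter_right (isClosed_Ici (a := t))).exists_isLeast
        ⟨1, h1, ht.2⟩
      exact ⟨s, fun _ => hs⟩
    · exact ⟨0, fun h => absurd h ht⟩
  choose ρ hρ using hρ
  choose σ hσ using hσ
  have hρK : ∀ t ∈ K, ρ t = t := fun t ht =>
    le_antisymm (hρ t (hK01 ht)).1.2 ((hρ t (hK01 ht)).2 ⟨ht, self_mem_Iic⟩)
  have hρσ : ∀ t ∈ Icc (0 : ℝ) 1, γ (ρ t) = γ (σ t) := by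
    intro t ht
    have hρt := hρ t ht
    have hσt := hσ t ht
    rcases (le_trans hρt.1.2 hσt.1.2 : ρ t ≤ σ t).eq_or_lt with h | h
    · rw [h]
    · refine (hgap _ hρt.1.1 _ hσt.1.1 h).mpr fun x hx hxK => ?_
      rcases le_total x t with hxt | hxt
      · exact absurd (hρt.2 ⟨hxK, hxt⟩) (not_le.mpr hx.1)
      · exact absurd (hσt.2 ⟨hxK, hxt⟩) (not_le.mpr hx.2)
  refine ⟨fun t => γ (ρ t), ?_, congrArg γ (hρK 0 h0), congrArg γ (hρK 1 h1),
    fun t ht => ⟨ρ t, hK01 (hρ t ht).1.1, rfl⟩, fun s hs t ht hst x hx => ?_⟩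
  · have huc := isCompact_Icc.uniformContinuousOn_of_continuous
      (hγ.continuousOn (s := Icc (0 : ℝ) 1))
    refine UniformContinuousOn.continuousOn (Metric.uniformContinuousOn_iff.mpr fun ε hε => ?_)
    obtain ⟨δ, hδ, h⟩ := Metric.uniformContinuousOn_iff.mp huc ε hε
    have step : ∀ s ∈ Icc (0 : ℝ) 1, ∀ t ∈ Icc (0 : ℝ) 1, s ≤ t → dist s t < δ →
        dist (γ (ρ s)) (γ (ρ t)) < ε := by
      intro s hs t ht hst hd
      have hρs := hρ s hs
      have hρt := hρ t ht
      have hσs := hσ s hs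
      rcases le_or_gt (ρ t) s with hle | hlt
      · have : ρ t = ρ s := le_antisymm (hρs.2 ⟨hρt.1.1, hle⟩)
          (hρt.2 ⟨hρs.1.1, le_trans hρs.1.2 hst⟩)
        rw [this, dist_self]
        exact hε
      · rw [hρσ s hs]
        have hle : σ s ≤ ρ t := hσs.2 ⟨hρt.1.1, hlt.le⟩
        have h3 : s ≤ σ s := hσs.1.2
        have h4 : ρ t ≤ t := hρt.1.2
        refine h _ (hK01 hσs.1.1) _ (hK01 hρt.1.1) (lt_of_le_of_lt ?_ hd)
        rw [Real.dist_eq, Real.dist_eq, abs_sub_comm, abs_sub_comm s, abs_of_nonneg (by linarith),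
          abs_of_nonneg (by linarith)]
        linarith
    refine ⟨δ, hδ, fun s hs t ht hd => ?_⟩
    rcases le_total s t with hst | hst
    · exact step s hs t ht hst hd
    · rw [dist_comm]
      exact step t ht s hs hst (by rwa [dist_comm])
  · have hx01 : x ∈ Icc (0 : ℝ) 1 := ⟨hs.1.trans hx.1, hx.2.trans ht.2⟩
    have hρs := hρ s hs
    have hρt := hρ t ht
    have hρx := hρ x hx01
    have l1 : ρ s ≤ ρ x := hρx.2 ⟨hρs.1.1, le_trans hρs.1.2 hx.1⟩
    have l2 : ρ x ≤ ρ t := hρt.2 ⟨hρx.1.1, le_trans hρx.1.2 hx.2⟩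
    dsimp only at hst ⊢
    rcases l1.eq_or_lt with e1 | l1
    · rw [← e1]
    rcases l2.eq_or_lt with e2 | l2
    · rw [e2, hst]
    exact absurd hρx.1.1 ((hgap _ hρs.1.1 _ hρt.1.1 (l1.trans l2)).mp hst _ ⟨l1, l2⟩)

/-- A nonconstant path with order-convex fibres can be reparametrized injectively. -/
lemma exists_injOn_reparametrization {X : Type*} [MetricSpace X] {η : ℝ → X} (hη : Continuous η)
    (hne : η 0 ≠ η 1)
    (hfib : ∀ s ∈ Icc (0 : ℝ) 1, ∀ t ∈ Icc (0 : ℝ) 1, η s = η t → ∀ x ∈ Icc s t, η x = η s) :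
    ∃ α : ℝ → X, Continuous α ∧ InjOn α (Icc 0 1) ∧ α 0 = η 0 ∧ α 1 = η 1 ∧
      ∀ t, α t ∈ η '' Icc 0 1 := by
  let m : ℝ → ℝ → ℝ := fun t r => sInf ((fun x => dist (η (t * x)) (η r)) '' Icc 0 1)
  have hmc : Continuous (Function.uncurry m) :=
    (isCompact_Icc (a := (0 : ℝ)) (b := 1)).continuous_sInf
      (f := fun (p : ℝ × ℝ) x => dist (η (p.1 * x)) (η p.2)) (by fun_prop)
  have hm : ∀ t, 0 ≤ t → ∀ r, IsLeast ((fun y => dist (η y) (η r)) '' Icc 0 t) (m t r) := by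
    intro t ht r
    have himg : (fun y => dist (η y) (η r)) '' Icc 0 t =
        (fun x => dist (η (t * x)) (η r)) '' Icc 0 1 := by
      have : Icc 0 t = (fun x => t * x) '' Icc 0 1 := by
        rw [image_mul_left_Icc ht zero_le_one, mul_zero, mul_one]
      rw [this, image_image]
    rw [himg]
    exact (isCompact_Icc.image (by fun_prop)).isLeast_sInf ((nonempty_Icc.mpr zero_le_one).image _)
  have hanti : ∀ s t, 0 ≤ s → s ≤ t → ∀ r, m t r ≤ m s r := fun s t hs hst r =>
    (hm s hs r).mono (hm t (hs.trans hst) r) (image_mono (Icc_subset_Icc_right hst))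
  let H : ℝ → ℝ := fun t => ∫ r in (0 : ℝ)..1, m t r
  have hH : Continuous H :=
    intervalIntegral.continuous_parametric_intervalIntegral_of_continuous' hmc 0 1
  have hlt : ∀ s ∈ Icc (0 : ℝ) 1, ∀ t ∈ Icc (0 : ℝ) 1, s < t → η s ≠ η t → H t < H s := by
    intro s hs t ht hst hst'
    refine intervalIntegral.integral_lt_integral_of_continuousOn_of_le_of_exists_lt zero_lt_one
      (by fun_prop) (by fun_prop) (fun r _ => hanti s t hs.1 hst.le r) ⟨t, ht, ?_⟩
    obtain ⟨y, hy, hye⟩ := (hm s hs.1 t).1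
    have h0 : m t t ≤ 0 := (hm t ht.1 t).2 ⟨t, ⟨ht.1, le_rfl⟩, dist_self _⟩
    refine h0.trans_lt ?_
    rw [← hye]
    refine dist_pos.mpr fun h => hst' ?_
    rw [hfib y ⟨hy.1, hy.2.trans hs.2⟩ t ht h s ⟨hy.2, hst.le⟩, h]
  have heq : ∀ s ∈ Icc (0 : ℝ) 1, ∀ t ∈ Icc (0 : ℝ) 1, s ≤ t → η s = η t → H t = H s := by
    intro s hs t ht hst hst'
    refine intervalIntegral.integral_congr fun r _ => le_antisymm (hanti s t hs.1 hst r) ?_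
    obtain ⟨y, hy, hye⟩ := (hm t ht.1 r).1
    rw [← hye]
    rcases le_total y s with hys | hys
    · exact (hm s hs.1 r).2 ⟨y, ⟨hy.1, hys⟩, rfl⟩
    · dsimp only
      rw [hfib s hs t ht hst' y ⟨hys, hy.2⟩]
      exact (hm s hs.1 r).2 ⟨s, ⟨hs.1, le_rfl⟩, rfl⟩
  have hle : ∀ s ∈ Icc (0 : ℝ) 1, ∀ t ∈ Icc (0 : ℝ) 1, s ≤ t → H t ≤ H s := by
    intro s hs t ht hst
    by_cases h : η s = η t
    · exact (heq s hs t ht hst h).le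
    · exact (hlt s hs t ht (lt_of_le_of_ne hst fun e => h (by rw [e])) h).le
  have hiff : ∀ s ∈ Icc (0 : ℝ) 1, ∀ t ∈ Icc (0 : ℝ) 1, (η s = η t ↔ H s = H t) := by
    have aux : ∀ s ∈ Icc (0 : ℝ) 1, ∀ t ∈ Icc (0 : ℝ) 1, s ≤ t → (η s = η t ↔ H s = H t) := by
      refine fun s hs t ht hst => ⟨fun h => (heq s hs t ht hst h).symm, fun h => ?_⟩
      by_contra h'
      exact (hlt s hs t ht (lt_of_le_of_ne hst fun e => h' (by rw [e])) h').ne' h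
    intro s hs t ht
    rcases le_total s t with h | h
    · exact aux s hs t ht h
    · rw [eq_comm, aux t ht s hs h, eq_comm]
  have h0 : (0 : ℝ) ∈ Icc (0 : ℝ) 1 := by simp
  have h1 : (1 : ℝ) ∈ Icc (0 : ℝ) 1 := by simp
  have hpos : 0 < H 0 - H 1 := sub_pos.mpr (hlt 0 h0 1 h1 zero_lt_one hne)
  let G : Icc (0 : ℝ) 1 → Icc (0 : ℝ) 1 := fun t => ⟨(H 0 - H t) / (H 0 - H 1),
    div_nonneg (sub_nonneg.mpr (hle 0 h0 t t.2 t.2.1)) hpos.le,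
    (div_le_one hpos).mpr (by linarith [hle t t.2 1 h1 t.2.2])⟩
  have hG : Continuous G := by
    refine Continuous.subtype_mk ?_ _
    fun_prop
  have hGiff : ∀ s t, G s = G t ↔ η s = η t := by
    intro s t
    rw [hiff s s.2 t t.2, Subtype.ext_iff]
    simp only [G]
    rw [div_left_inj' hpos.ne', sub_right_inj]
  have hG0 : G ⟨0, h0⟩ = ⟨0, h0⟩ := Subtype.ext (by simp [G])
  have hG1 : G ⟨1, h1⟩ = ⟨1, h1⟩ := Subtype.ext (by simp [G, hpos.ne'])
  have hGs : Function.Surjective G := by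
    intro u
    have := intermediate_value_univ (⟨0, h0⟩ : Icc (0 : ℝ) 1) ⟨1, h1⟩ hG
    rw [hG0, hG1] at this
    exact this ⟨u.2.1, u.2.2⟩
  choose τ hτ using hGs
  have hατ : ∀ t, η (τ (G t)) = η t := fun t => (hGiff _ _).mp (hτ _)
  have hquot := hG.isClosedMap.isQuotientMap hG fun u => ⟨τ u, hτ u⟩
  have hαc : Continuous fun u => η (τ u) := by
    rw [hquot.continuous_iff]
    have : (fun u => η (τ u)) ∘ G = fun t : Icc (0 : ℝ) 1 => η t := funext hατ
    rw [this]
    fun_prop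
  refine ⟨IccExtend zero_le_one fun u => η (τ u), hαc.Icc_extend', ?_, ?_, ?_,
    fun t => ⟨_, (τ _).2, rfl⟩⟩
  · intro s hs t ht hst
    rw [IccExtend_of_mem _ _ hs, IccExtend_of_mem _ _ ht, ← hGiff, hτ, hτ] at hst
    exact congrArg Subtype.val hst
  · rw [IccExtend_of_mem _ _ h0, ← hG0, hατ]
  · rw [IccExtend_of_mem _ _ h1, ← hG1, hατ]

/-- A path between distinct points contains an arc between them. -/
lemma exists_arc_of_continuous {X : Type*} [MetricSpace X] {γ : ℝ → X} (hγ : Continuous γ)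
    (hne : γ 0 ≠ γ 1) :
    ∃ α : ℝ → X, Continuous α ∧ InjOn α (Icc 0 1) ∧ α 0 = γ 0 ∧ α 1 = γ 1 ∧
      ∀ t, α t ∈ γ '' Icc 0 1 := by
  obtain ⟨η, hηc, hη0, hη1, hηm, hfib⟩ := exists_monotone_path hγ
  let η' := IccExtend (zero_le_one (α := ℝ)) ((Icc 0 1).domRestrict η)
  have hη' : ∀ t ∈ Icc (0 : ℝ) 1, η' t = η t := fun t ht => IccExtend_of_mem _ _ ht
  have h0 : (0 : ℝ) ∈ Icc (0 : ℝ) 1 := by simp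
  have h1 : (1 : ℝ) ∈ Icc (0 : ℝ) 1 := by simp
  obtain ⟨α, hαc, hαi, hα0, hα1, hαm⟩ := exists_injOn_reparametrization (η := η')
    (continuousOn_iff_continuous_domRestrict.mp hηc).Icc_extend'
    (by rwa [hη' 0 h0, hη' 1 h1, hη0, hη1])
    (fun s hs t ht hst x hx => by
      rw [hη' s hs] at hst ⊢
      rw [hη' t ht] at hst
      rw [hη' x ⟨hs.1.trans hx.1, hx.2.trans ht.2⟩]
      exact hfib s hs t ht hst x hx)
  refine ⟨α, hαc, hαi, by rw [hα0, hη' 0 h0, hη0], by rw [hα1, hη' 1 h1, hη1], fun t => ?_⟩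
  obtain ⟨x, hx, hxt⟩ := hαm t
  rw [← hxt, hη' x hx]
  exact hηm hx

/-- Two arcs which share exactly their endpoints form a simple closed curve. -/
lemma exists_circle_of_arcs_s3 {X : Type*} [TopologicalSpace X] {a b : ℝ → X} (ha : Continuous a)
    (hb : Continuous b) (hai : InjOn a (Icc 0 1)) (hbi : InjOn b (Icc 0 1)) (h01 : a 0 = b 1)
    (h10 : a 1 = b 0) (hab : ∀ s ∈ Ioo (0 : ℝ) 1, ∀ t ∈ Icc (0 : ℝ) 1, a s ≠ b t) :
    ∃ g : Circle → X, Continuous g ∧ Function.Injective g ∧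
      range g ⊆ a '' Icc 0 1 ∪ b '' Icc 0 1 := by
  have : Fact ((0 : ℝ) < 2) := ⟨two_pos⟩
  let h : ℝ → X := fun θ => if θ ≤ 1 then a θ else b (θ - 1)
  have hc : Continuous h := by
    refine Continuous.if_le ha (by fun_prop) continuous_id continuous_const fun x hx => ?_
    rw [show x = 1 from hx, h10, sub_self]
  have hle : ∀ θ ≤ 1, h θ = a θ := fun θ hθ => if_pos hθ
  have hgt : ∀ θ, 1 < θ → h θ = b (θ - 1) := fun θ hθ => if_neg (not_le.mpr hθ)
  have hne : ∀ s ∈ Ico (0 : ℝ) 2, ∀ t ∈ Ico (0 : ℝ) 2, s ≤ 1 → 1 < t → h s ≠ h t := by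
    intro s hs t ht hs1 ht1
    rw [hle s hs1, hgt t ht1]
    have ht' : t - 1 ∈ Icc (0 : ℝ) 1 := ⟨by linarith, by linarith [ht.2]⟩
    rcases hs.1.eq_or_lt with rfl | hs0
    · rw [h01]
      intro e
      linarith [hbi (by simp) ht' e, ht.2]
    rcases hs1.eq_or_lt with rfl | hs1
    · rw [h10]
      intro e
      linarith [hbi (by simp) ht' e]
    exact hab s ⟨hs0, hs1⟩ _ ht'
  have hinj : InjOn h (Ico 0 2) := by
    intro s hs t ht hst
    rcases le_or_gt s 1 with hs1 | hs1 <;> rcases le_or_gt t 1 with ht1 | ht1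
    · rw [hle s hs1, hle t ht1] at hst
      exact hai ⟨hs.1, hs1⟩ ⟨ht.1, ht1⟩ hst
    · exact absurd hst (hne s hs t ht hs1 ht1)
    · exact absurd hst.symm (hne t ht s hs ht1 hs1)
    · rw [hgt s hs1, hgt t ht1] at hst
      linarith [hbi ⟨by linarith, by linarith [hs.2]⟩ ⟨by linarith, by linarith [ht.2]⟩ hst]
  have h02 : h 0 = h 2 := by
    rw [hle 0 zero_le_one, hgt 2 one_lt_two, h01]
    norm_num
  have hrep : ∀ z : AddCircle (2 : ℝ), ∃ θ ∈ Ico (0 : ℝ) 2, (θ : AddCircle (2 : ℝ)) = z := by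
    intro z
    obtain ⟨θ, hθ, hz⟩ := AddCircle.coe_image_Ico_eq (2 : ℝ) 0 ▸ mem_univ z
    exact ⟨θ, by simpa using hθ, hz⟩
  let e := AddCircle.homeomorphCircle (T := 2) two_ne_zero
  refine ⟨AddCircle.liftIco 2 0 h ∘ e.symm,
    (AddCircle.liftIco_zero_continuous h02 hc.continuousOn).comp e.symm.continuous,
    Function.Injective.comp (fun z w hzw => ?_) e.symm.injective, ?_⟩
  · obtain ⟨s, hs, rfl⟩ := hrep z
    obtain ⟨t, ht, rfl⟩ := hrep w
    rw [AddCircle.liftIco_zero_coe_apply hs, AddCircle.liftIco_zero_coe_apply ht] at hzw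
    rw [hinj hs ht hzw]
  · rintro _ ⟨z, rfl⟩
    obtain ⟨s, hs, hz⟩ := hrep (e.symm z)
    rw [Function.comp_apply, ← hz, AddCircle.liftIco_zero_coe_apply hs]
    rcases le_or_gt s 1 with hs1 | hs1
    · exact Or.inl ⟨s, ⟨hs.1, hs1⟩, (hle s hs1).symm⟩
    · exact Or.inr ⟨s - 1, ⟨by linarith, by linarith [hs.2]⟩, (hgt s hs1).symm⟩

/-- Two arcs with the same ends, one of which passes through a point missed by the other, contain
a simple closed curve. -/
lemma exists_circle_of_arc_avoiding {X : Type*} [MetricSpace X] {α β : ℝ → X} (hα : Continuous α)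
    (hβ : Continuous β) (hαi : InjOn α (Icc 0 1)) (hβi : InjOn β (Icc 0 1)) (h0 : α 0 = β 0)
    (h1 : α 1 = β 1) {t : ℝ} (ht : t ∈ Icc (0 : ℝ) 1) (htβ : α t ∉ β '' Icc 0 1) :
    ∃ g : Circle → X, Continuous g ∧ Function.Injective g ∧
      range g ⊆ α '' Icc 0 1 ∪ β '' Icc 0 1 := by
  have hcl : IsClosed (α ⁻¹' (β '' Icc 0 1)) :=
    (isCompact_Icc.image hβ).isClosed.preimage hα
  obtain ⟨s, ⟨hst, s', hs', hss'⟩, hsmax⟩ :=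
    (isCompact_Icc (a := (0 : ℝ)) (b := t)).inter_right hcl |>.exists_isGreatest
      ⟨0, ⟨le_rfl, ht.1⟩, 0, by simp, h0.symm⟩
  obtain ⟨u, ⟨hut, u', hu', huu'⟩, humin⟩ :=
    (isCompact_Icc (a := t) (b := (1 : ℝ))).inter_right hcl |>.exists_isLeast
      ⟨1, ⟨ht.2, le_rfl⟩, 1, by simp, h1.symm⟩
  have hs01 : s ∈ Icc (0 : ℝ) 1 := ⟨hst.1, hst.2.trans ht.2⟩
  have hu01 : u ∈ Icc (0 : ℝ) 1 := ⟨ht.1.trans hut.1, hut.2⟩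
  have hst' : s < t := lt_of_le_of_ne hst.2 fun e => htβ ⟨s', hs', by rw [hss', e]⟩
  have hut' : t < u := lt_of_le_of_ne hut.1 fun e => htβ ⟨u', hu', by rw [huu', e]⟩
  have hsu : s < u := hst'.trans hut'
  have hne : s' ≠ u' := by
    rintro rfl
    exact hsu.ne (hαi hs01 hu01 (hss'.symm.trans huu'))
  have hconv : ∀ p ∈ Icc (0 : ℝ) 1, ∀ q ∈ Icc (0 : ℝ) 1, ∀ x ∈ Icc (0 : ℝ) 1,
      p + (q - p) * x ∈ Icc (0 : ℝ) 1 := by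
    intro p hp q hq x hx
    have e : p + (q - p) * x = (1 - x) * p + x * q := by ring
    have := convex_Icc (0 : ℝ) 1 hp hq (sub_nonneg.mpr hx.2) hx.1 (by ring)
    rwa [smul_eq_mul, smul_eq_mul, ← e] at this
  have hcirc : ∃ g : Circle → X, Continuous g ∧ Function.Injective g ∧
      range g ⊆ (fun x => α (s + (u - s) * x)) '' Icc 0 1 ∪
        (fun x => β (u' + (s' - u') * x)) '' Icc 0 1 := by
    refine exists_circle_of_arcs_s3 (by fun_prop) (by fun_prop) ?_ ?_ ?_ ?_ ?_
    · intro x hx y hy hxy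
      have := hαi (hconv s hs01 u hu01 x hx) (hconv s hs01 u hu01 y hy) hxy
      exact mul_left_cancel₀ (sub_pos.mpr hsu).ne' (add_left_cancel this)
    · intro x hx y hy hxy
      have := hβi (hconv u' hu' s' hs' x hx) (hconv u' hu' s' hs' y hy) hxy
      exact mul_left_cancel₀ (sub_ne_zero.mpr hne) (add_left_cancel this)
    · simp [hss']
    · simp [huu']
    · intro x hx y hy hxy
      have hl : 0 < (u - s) * x := mul_pos (sub_pos.mpr hsu) hx.1
      have hr : (u - s) * x < u - s := mul_lt_of_lt_one_right (sub_pos.mpr hsu) hx.2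
      have hmem : s + (u - s) * x ∈ α ⁻¹' (β '' Icc 0 1) :=
        ⟨_, hconv u' hu' s' hs' y hy, hxy.symm⟩
      have h01 := hconv s hs01 u hu01 x ⟨hx.1.le, hx.2.le⟩
      rcases le_total (s + (u - s) * x) t with h | h
      · linarith [hsmax ⟨⟨h01.1, h⟩, hmem⟩]
      · linarith [humin ⟨⟨h, h01.2⟩, hmem⟩]
  obtain ⟨g, hg, hgi, hgr⟩ := hcirc
  refine ⟨g, hg, hgi, hgr.trans (union_subset_union ?_ ?_)⟩
  · rintro _ ⟨x, hx, rfl⟩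
    exact mem_image_of_mem α (hconv s hs01 u hu01 x hx)
  · rintro _ ⟨x, hx, rfl⟩
    exact mem_image_of_mem β (hconv u' hu' s' hs' x hx)

/-- A relatively open connected subset of a compact locally connected set is arcwise connected. -/
lemma exists_arc_of_isPreconnected {X : Type*} [MetricSpace X] {D K : Set X} (hD : IsCompact D)
    [LocallyConnectedSpace D] (hKD : K ⊆ D) (hKo : ∀ z ∈ K, K ∈ 𝓝[D] z) (hK : IsPreconnected K)
    {a b : X} (ha : a ∈ K) (hb : b ∈ K) (hab : a ≠ b) :
    ∃ α : ℝ → X, Continuous α ∧ InjOn α (Icc 0 1) ∧ α 0 = a ∧ α 1 = b ∧ ∀ t, α t ∈ K := by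
  have : CompactSpace D := isCompact_iff_compactSpace.mp hD
  have := LocallyConnectedSpace.locallyPathConnectedSpace D
  let V : Set D := (↑) ⁻¹' K
  have hVo : IsOpen V := isOpen_iff_mem_nhds.mpr fun z hz =>
    preimage_coe_mem_nhds_subtype.mpr (hKo z hz)
  have hVc : IsPreconnected V := by
    rw [← IsInducing.subtypeVal.isPreconnected_image, Subtype.image_preimage_coe,
      inter_eq_right.mpr hKD]
    exact hK
  have hpath := hVo.isConnected_iff_isPathConnected.mp ⟨⟨⟨a, hKD ha⟩, ha⟩, hVc⟩
  obtain ⟨γ, hγ⟩ := hpath.joinedIn ⟨a, hKD ha⟩ ha ⟨b, hKD hb⟩ hb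
  obtain ⟨α, hα, hαi, hα0, hα1, hαm⟩ := exists_arc_of_continuous
    (γ := fun t => (γ.extend t : X)) (by fun_prop) (by simpa using hab)
  refine ⟨α, hα, hαi, by simpa using hα0, by simpa using hα1, fun t => ?_⟩
  obtain ⟨x, hx, hxt⟩ := hαm t
  rw [← hxt]
  dsimp only
  rw [γ.extend_apply hx]
  exact hγ _

/-- Components of the complement of a point in a locally connected set are relatively open. -/
lemma connectedComponentIn_sdiff_mem_nhdsWithin {X : Type*} [TopologicalSpace X] [T1Space X]
    {D : Set X} [LocallyConnectedSpace D] {c y z : X}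
    (hz : z ∈ connectedComponentIn (D \ {c}) y) :
    connectedComponentIn (D \ {c}) y ∈ 𝓝[D] z := by
  have hzD := connectedComponentIn_subset _ _ hz
  have hopen : IsOpen {w : D | (w : X) ≠ c} :=
    isOpen_compl_singleton.preimage continuous_subtype_val
  obtain ⟨V, hV, hVo, hzV, hVc⟩ := locallyConnectedSpace_iff_subsets_isOpen_isConnected.mp ‹_›
    ⟨z, hzD.1⟩ _ (hopen.mem_nhds hzD.2)
  rw [connectedComponentIn_eq hz]
  have hsub : ((↑) : D → X) '' V ⊆ connectedComponentIn (D \ {c}) z := by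
    have hVp := hVc.isPreconnected.image _ continuous_subtype_val.continuousOn
    refine hVp.subset_connectedComponentIn ⟨⟨z, hzD.1⟩, hzV, rfl⟩ ?_
    rintro _ ⟨w, hw, rfl⟩
    exact ⟨w.2, hV hw⟩
  exact preimage_coe_mem_nhds_subtype.mp
    (mem_of_superset (hVo.mem_nhds hzV) (image_subset_iff.mp hsub))

/-- Adding the removed point to a component of its complement gives a connected set. -/
lemma isPreconnected_insert_connectedComponentIn {X : Type*} [TopologicalSpace X] [T1Space X]
    {D : Set X} (hD : IsPreconnected D) [LocallyConnectedSpace D] {c y : X} (hc : c ∈ D)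
    (hy : y ∈ D \ {c}) : IsPreconnected (insert c (connectedComponentIn (D \ {c}) y)) := by
  set K := connectedComponentIn (D \ {c}) y with hK
  have hcK : c ∉ K := fun h => (connectedComponentIn_subset _ _ h).2 rfl
  refine isPreconnected_connectedComponentIn.subset_closure (subset_insert _ _)
    (insert_subset ?_ subset_closure)
  by_contra hcl
  have key : (y ∈ K ↔ c ∈ K) := by
    refine hD.induction₂ (fun z w => (z ∈ K ↔ w ∈ K)) (fun z hz => ?_)
      (fun _ _ _ _ _ _ h h' => h.trans h') (fun _ _ _ _ h => h.symm) hy.1 hc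
    by_cases hzK : z ∈ K
    · filter_upwards [connectedComponentIn_sdiff_mem_nhdsWithin hzK] with w hw
      exact iff_of_true hzK hw
    by_cases hzc : z = c
    · subst hzc
      filter_upwards [mem_nhdsWithin_of_mem_nhds (isClosed_closure.isOpen_compl.mem_nhds hcl)]
        with w hw
      exact iff_of_false hzK fun h => hw (subset_closure h)
    · filter_upwards [connectedComponentIn_sdiff_mem_nhdsWithin
        (mem_connectedComponentIn (show z ∈ D \ {c} from ⟨hz, hzc⟩))] with w hw
      refine iff_of_false hzK fun h => hzK ?_
      rw [hK, connectedComponentIn_eq h, ← connectedComponentIn_eq hw]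
      exact mem_connectedComponentIn ⟨hz, hzc⟩
  exact hcK (key.mp (mem_connectedComponentIn hy))

/-- If the component of `φ t₀` in the complement of the arc point `α t₀` misses `α 1`, then for
slightly later times `t` the component of `φ t` in the complement of `α t` contains `α 0`. -/
lemma exists_mem_connectedComponentIn_right {X : Type*} [TopologicalSpace X] [T1Space X]
    {D : Set X} (hD : IsPreconnected D) [LocallyConnectedSpace D] {α φ : ℝ → X}
    (hα : Continuous α) (hαi : InjOn α (Icc 0 1)) (hαD : MapsTo α (Icc 0 1) D)
    (hφ : ContinuousOn φ (Icc 0 1)) (hφD : MapsTo φ (Icc 0 1) D) {t₀ : ℝ} (h0 : 0 ≤ t₀)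
    (h1 : t₀ < 1) (hne : φ t₀ ≠ α t₀)
    (hend : α 1 ∉ connectedComponentIn (D \ {α t₀}) (φ t₀)) :
    ∃ ε > 0, ∀ t ∈ Ioo t₀ (t₀ + ε), t ≤ 1 → α 0 ∈ connectedComponentIn (D \ {α t}) (φ t) := by
  have ht₀ : t₀ ∈ Icc (0 : ℝ) 1 := ⟨h0, h1.le⟩
  have hφt₀ : φ t₀ ∈ D \ {α t₀} := ⟨hφD ht₀, hne⟩
  set K := connectedComponentIn (D \ {α t₀}) (φ t₀) with hK
  have hnear : ∀ᶠ t in 𝓝[Icc 0 1] t₀, φ t ∈ K :=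
    (tendsto_nhdsWithin_iff.mpr ⟨hφ t₀ ht₀, eventually_mem_nhdsWithin.mono fun t ht => hφD ht⟩)
      (connectedComponentIn_sdiff_mem_nhdsWithin (mem_connectedComponentIn hφt₀))
  obtain ⟨ε, hε, hball⟩ := Metric.mem_nhdsWithin_iff.mp hnear
  refine ⟨ε, hε, fun t ht ht1 => ?_⟩
  have ht01 : t ∈ Icc (0 : ℝ) 1 := ⟨h0.trans ht.1.le, ht1⟩
  have htK : φ t ∈ K := hball ⟨by
    rw [Metric.mem_ball, Real.dist_eq, abs_lt]
    constructor <;> linarith [ht.1, ht.2], ht01⟩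
  have hαt : α t ∉ K := by
    intro h
    have hsub : α '' Icc t 1 ⊆ connectedComponentIn (D \ {α t₀}) (α t) := by
      refine (isPreconnected_Icc.image α hα.continuousOn).subset_connectedComponentIn
        ⟨t, ⟨le_rfl, ht1⟩, rfl⟩ ?_
      rintro _ ⟨x, hx, rfl⟩
      have hx01 : x ∈ Icc (0 : ℝ) 1 := ⟨ht01.1.trans hx.1, hx.2⟩
      exact ⟨hαD hx01, fun e => by linarith [hαi hx01 ht₀ e, hx.1, ht.1]⟩
    rw [← connectedComponentIn_eq h] at hsub
    exact hend (hsub ⟨1, ⟨ht1, le_rfl⟩, rfl⟩)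
  have hconn : IsPreconnected (insert (α t₀) K ∪ α '' Icc 0 t₀) :=
    (isPreconnected_insert_connectedComponentIn hD (hαD ht₀) hφt₀).union (α t₀)
      (mem_insert _ _) ⟨t₀, ⟨h0, le_rfl⟩, rfl⟩ (isPreconnected_Icc.image α hα.continuousOn)
  refine hconn.subset_connectedComponentIn (x := φ t) (Or.inl (Or.inr htK)) ?_
    (Or.inr ⟨0, ⟨le_rfl, h0⟩, rfl⟩)
  rintro w ((rfl | hw) | ⟨x, hx, rfl⟩)
  · exact ⟨hαD ht₀, fun e => ht.1.ne (hαi ht₀ ht01 e)⟩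
  · exact ⟨(connectedComponentIn_subset _ _ hw).1, fun e => hαt (by rwa [← show w = α t from e])⟩
  · have hx01 : x ∈ Icc (0 : ℝ) 1 := ⟨hx.1, hx.2.trans h1.le⟩
    exact ⟨hαD hx01, fun e => by linarith [hαi hx01 ht01 e, hx.2, ht.1]⟩

/-- If the component of `φ t₀` in the complement of the arc point `α t₀` misses `α 0`, then for
slightly earlier times `t` the component of `φ t` in the complement of `α t` contains `α 1`. -/
lemma exists_mem_connectedComponentIn_left {X : Type*} [TopologicalSpace X] [T1Space X]
    {D : Set X} (hD : IsPreconnected D) [LocallyConnectedSpace D] {α φ : ℝ → X}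
    (hα : Continuous α) (hαi : InjOn α (Icc 0 1)) (hαD : MapsTo α (Icc 0 1) D)
    (hφ : ContinuousOn φ (Icc 0 1)) (hφD : MapsTo φ (Icc 0 1) D) {t₀ : ℝ} (h0 : 0 < t₀)
    (h1 : t₀ ≤ 1) (hne : φ t₀ ≠ α t₀)
    (hend : α 0 ∉ connectedComponentIn (D \ {α t₀}) (φ t₀)) :
    ∃ ε > 0, ∀ t ∈ Ioo (t₀ - ε) t₀, 0 ≤ t → α 1 ∈ connectedComponentIn (D \ {α t}) (φ t) := by
  have hrev : MapsTo (fun t : ℝ => 1 - t) (Icc 0 1) (Icc 0 1) := fun t ht =>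
    ⟨by linarith [ht.2], by linarith [ht.1]⟩
  obtain ⟨ε, hε, h⟩ := exists_mem_connectedComponentIn_right hD (α := fun t => α (1 - t))
    (φ := fun t => φ (1 - t)) (t₀ := 1 - t₀) (by fun_prop)
    (fun s hs t ht e => by linarith [hαi (hrev hs) (hrev ht) e]) (fun t ht => hαD (hrev ht))
    (hφ.comp (by fun_prop) hrev) (fun t ht => hφD (hrev ht)) (by linarith) (by linarith)
    (by simpa using hne) (by simpa using hend)
  refine ⟨ε, hε, fun t ht ht0 => ?_⟩
  simpa using h (1 - t) ⟨by linarith [ht.2], by linarith [ht.1]⟩ (by linarith)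

/-- Interior points of an arc in a dendrite separate its ends. -/
lemma IsDendrite.connectedComponentIn_ne {X : Type*} [MetricSpace X] {D : Set X}
    (hD : IsDendrite D) {α : ℝ → X} (hα : Continuous α) (hαi : InjOn α (Icc 0 1))
    (hαD : MapsTo α (Icc 0 1) D) {t : ℝ} (ht : t ∈ Ioo (0 : ℝ) 1) :
    connectedComponentIn (D \ {α t}) (α 0) ≠ connectedComponentIn (D \ {α t}) (α 1) := by
  obtain ⟨-, hcomp, -, hlc, hscc⟩ := hD
  have h0 : (0 : ℝ) ∈ Icc (0 : ℝ) 1 := by simp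
  have h1 : (1 : ℝ) ∈ Icc (0 : ℝ) 1 := by simp
  have ht' : t ∈ Icc (0 : ℝ) 1 := Ioo_subset_Icc_self ht
  intro heq
  have hm0 : α 0 ∈ D \ {α t} := ⟨hαD h0, fun e => ht.1.ne (hαi h0 ht' e)⟩
  have hm1 : α 1 ∈ D \ {α t} := ⟨hαD h1, fun e => ht.2.ne' (hαi h1 ht' e)⟩
  have hsub := connectedComponentIn_subset (D \ {α t}) (α 0)
  obtain ⟨β, hβ, hβi, hβ0, hβ1, hβK⟩ := exists_arc_of_isPreconnected hcomp
    (hsub.trans sdiff_subset) (fun z hz => connectedComponentIn_sdiff_mem_nhdsWithin hz)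
    isPreconnected_connectedComponentIn (mem_connectedComponentIn hm0)
    (heq ▸ mem_connectedComponentIn hm1) (fun e => zero_ne_one (hαi h0 h1 e))
  obtain ⟨g, hg, hgi, hgr⟩ := exists_circle_of_arc_avoiding hα hβ hαi hβi hβ0.symm hβ1.symm ht'
    (by
      rintro ⟨x, -, hx⟩
      exact (hsub (hβK x)).2 hx)
  refine hscc g hg (hgr.trans (union_subset (image_subset_iff.mpr hαD) ?_)) hgi
  rintro _ ⟨x, -, rfl⟩
  exact (hsub (hβK x)).1

/-- If `e₁ ≠ e₂` in `D₁` are such that each `eᵢ` separates `f(eᵢ)` from the other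
point in `D₂`, then `f` has a fixed point in the open arc `(e₁, e₂)`, i.e. a fixed
point separating `e₁` from `e₂`. -/
theorem dendrite_fixed_point_between {X : Type*} [MetricSpace X] {D₁ D₂ : Set X}
    (h₁ : IsDendrite D₁) (h₂ : IsDendrite D₂) (hsub : D₁ ⊆ D₂)
    (f : X → X) (hf : ContinuousOn f D₁) (hmaps : Set.MapsTo f D₁ D₂)
    (e₁ e₂ : X) (he₁ : e₁ ∈ D₁) (he₂ : e₂ ∈ D₁) (hne : e₁ ≠ e₂)
    (hs₁ : SeparatesIn D₂ e₁ (f e₁) e₂) (hs₂ : SeparatesIn D₂ e₂ (f e₂) e₁) :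
    ∃ c ∈ D₁, f c = c ∧ SeparatesIn D₂ c e₁ e₂ := by
  have hsep := h₂
  obtain ⟨-, hc₁, hconn₁, hlc₁, -⟩ := h₁
  obtain ⟨-, -, hconn₂, hlc₂, -⟩ := h₂
  obtain ⟨α, hα, hαi, rfl, rfl, hαD₁⟩ := exists_arc_of_isPreconnected hc₁ subset_rfl
    (fun z _ => self_mem_nhdsWithin) hconn₁.isPreconnected he₁ he₂ hne
  have hαD : MapsTo α (Icc 0 1) D₂ := fun t _ => hsub (hαD₁ t)
  have hφ : ContinuousOn (fun t => f (α t)) (Icc 0 1) :=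
    hf.comp hα.continuousOn fun t _ => hαD₁ t
  have hφD : MapsTo (fun t => f (α t)) (Icc 0 1) D₂ := fun t _ => hmaps (hαD₁ t)
  have hright {t₀ : ℝ} := exists_mem_connectedComponentIn_right (t₀ := t₀)
    hconn₂.isPreconnected hα hαi hαD hφ hφD
  have hleft {t₀ : ℝ} := exists_mem_connectedComponentIn_left (t₀ := t₀)
    hconn₂.isPreconnected hα hαi hαD hφ hφD
  have hboth : ∀ t ∈ Ioo (0 : ℝ) 1, α 0 ∈ connectedComponentIn (D₂ \ {α t}) (f (α t)) →
      α 1 ∉ connectedComponentIn (D₂ \ {α t}) (f (α t)) := fun t ht h0 h1 =>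
    hsep.connectedComponentIn_ne hα hαi hαD ht
      ((connectedComponentIn_eq h0).symm.trans (connectedComponentIn_eq h1))
  -- the times at which `f` moves the arc point towards `α 0`
  let N : Set ℝ := {t ∈ Ioo (0 : ℝ) 1 | α 0 ∈ connectedComponentIn (D₂ \ {α t}) (f (α t))}
  obtain ⟨ε, hε, hεN⟩ := hright le_rfl zero_lt_one hs₁.1.2
    fun h => hs₁.2.2 (connectedComponentIn_eq h)
  obtain ⟨δ, hδ, hδN⟩ := hleft zero_lt_one le_rfl hs₂.1.2
    fun h => hs₂.2.2 (connectedComponentIn_eq h)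
  have hmin : 0 < min ε 1 := lt_min hε zero_lt_one
  have hmem : min ε 1 / 2 ∈ N :=
    ⟨⟨by linarith, by linarith [min_le_right ε 1]⟩,
      hεN _ ⟨by linarith, by linarith [min_le_left ε 1]⟩ (by linarith [min_le_right ε 1])⟩
  have hub : 1 - δ ∈ upperBounds N := fun t ht => by
    by_contra! hlt
    exact hboth t ht.1 ht.2 (hδN t ⟨hlt, ht.1.2⟩ ht.1.1.le)
  have hbdd : BddAbove N := ⟨_, hub⟩
  set t₀ := sSup N
  have h0 : 0 < t₀ := hmem.1.1.trans_le (le_csSup hbdd hmem)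
  have h1 : t₀ < 1 := (csSup_le ⟨_, hmem⟩ hub).trans_lt (by linarith)
  have h01 : t₀ ∈ Icc (0 : ℝ) 1 := ⟨h0.le, h1.le⟩
  refine ⟨α t₀, hαD₁ t₀, ?_, ⟨hsub he₁, fun e => h0.ne (hαi (by simp) h01 e)⟩,
    ⟨hsub he₂, fun e => h1.ne' (hαi (by simp) h01 e)⟩,
    hsep.connectedComponentIn_ne hα hαi hαD ⟨h0, h1⟩⟩
  by_contra hfix
  by_cases hend : α 1 ∈ connectedComponentIn (D₂ \ {α t₀}) (f (α t₀))
  · obtain ⟨η, hη, hηN⟩ := hleft h0 h1.le hfix fun h => hboth t₀ ⟨h0, h1⟩ h hend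
    obtain ⟨t, htN, ht⟩ := exists_lt_of_lt_csSup ⟨_, hmem⟩ (show t₀ - η < sSup N by linarith)
    rcases (le_csSup hbdd htN).eq_or_lt with e | hlt
    · exact hboth t htN.1 htN.2 (by rwa [e])
    · exact hboth t htN.1 htN.2 (hηN t ⟨ht, hlt⟩ htN.1.1.le)
  · obtain ⟨η, hη, hηN⟩ := hright h0.le h1 hfix hend
    have hpos : 0 < min η (1 - t₀) := lt_min hη (by linarith)
    have hl := min_le_left η (1 - t₀)
    have hr := min_le_right η (1 - t₀)
    have hN : t₀ + min η (1 - t₀) / 2 ∈ N :=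
      ⟨⟨by linarith, by linarith⟩, hηN _ ⟨by linarith, by linarith⟩ (by linarith)⟩
    linarith [le_csSup hbdd hN]
end

section
/- Let D₁ ⊆ D₂ be dendrites, f : D₁ → D₂ continuous, E = closure(D₂ \ D₁) ∩ D₁, and suppose f scrambles the boundary: for every non-fixed point e ∈ E, f(e) lies in a component of D₂ \ {e} that meets D₁. Then f has a fixed point in D₁. -/
open Set Filter Topology

/-- Two points are `ε`-linked if a connected open set of diameter at most `ε` contains both. -/
def Linked {Y : Type*} [MetricSpace Y] (ε : ℝ) (u v : Y) : Prop :=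
  ∃ W : Set Y, IsOpen W ∧ IsPreconnected W ∧ u ∈ W ∧ v ∈ W ∧ ∀ a ∈ W, ∀ b ∈ W, dist a b ≤ ε

section PathConnected

variable {Y : Type*} [MetricSpace Y]

theorem Linked.symm {ε : ℝ} {u v : Y} (h : Linked ε u v) : Linked ε v u := by
  obtain ⟨W, hW, hc, hu, hv, hd⟩ := h
  exact ⟨W, hW, hc, hv, hu, hd⟩

theorem Linked.dist_le {ε : ℝ} {u v : Y} (h : Linked ε u v) : dist u v ≤ ε := by
  obtain ⟨W, -, -, hu, hv, hd⟩ := h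
  exact hd u hu v hv

/-- In a locally connected space, nearby points are linked. -/
theorem eventually_linked [LocallyConnectedSpace Y] {ε : ℝ} (hε : 0 < ε) (x : Y) :
    ∀ᶠ y in 𝓝 x, Linked ε x y := by
  obtain ⟨W, hW, hWo, hxW, hWc⟩ := locallyConnectedSpace_iff_subsets_isOpen_isConnected.1
    ‹_› x _ (Metric.ball_mem_nhds x (half_pos hε))
  filter_upwards [hWo.mem_nhds hxW] with y hy
  refine ⟨W, hWo, hWc.isPreconnected, hxW, hy, fun a ha b hb => ?_⟩
  have h₁ : dist a x < ε / 2 := hW ha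
  have h₂ : dist b x < ε / 2 := hW hb
  linarith [dist_triangle_right a b x]

/-- Any two points of a connected set are joined by chains of linked points of every large
enough length. -/
theorem IsPreconnected.exists_linked_chain [LocallyConnectedSpace Y] {V : Set Y}
    (hV : IsPreconnected V) {ε : ℝ} (hε : 0 < ε) {x y : Y} (hx : x ∈ V) (hy : y ∈ V) :
    ∃ M : ℕ, ∀ m ≥ M, ∃ q : ℕ → Y, q 0 = x ∧ q m = y ∧ (∀ j, q j ∈ V) ∧
      ∀ j < m, Linked ε (q j) (q (j + 1)) := by
  have hchain : Relation.ReflTransGen (fun u v => v ∈ V ∧ u ∈ V ∧ Linked ε u v) x y := by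
    refine hV.induction₂ _ (fun u hu => ?_) (fun _ _ _ _ _ _ => Relation.ReflTransGen.trans)
      (fun u v _ _ huv => ?_) hx hy
    · filter_upwards [self_mem_nhdsWithin, mem_nhdsWithin_of_mem_nhds (eventually_linked hε u)]
        with v hv h
      exact .single ⟨hv, hu, h⟩
    · have : Std.Symm fun u v => v ∈ V ∧ u ∈ V ∧ Linked ε u v :=
        ⟨fun _ _ h => ⟨h.2.1, h.1, h.2.2.symm⟩⟩
      exact Relation.ReflTransGen.stdSymm.symm _ _ huv
  induction hchain with
  | refl =>
    exact ⟨0, fun m _ => ⟨fun _ => x, rfl, rfl, fun _ => hx,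
      fun _ _ => (eventually_linked hε x).self_of_nhds⟩⟩
  | @tail u v _ huv ih =>
    obtain ⟨M, hM⟩ := ih huv.2.1
    refine ⟨M + 1, fun m hm => ?_⟩
    obtain ⟨k, rfl⟩ : ∃ k, m = k + 1 := ⟨m - 1, by omega⟩
    obtain ⟨q, h0, hk, hqV, hq⟩ := hM k (by omega)
    refine ⟨fun j => if j ≤ k then q j else v, by simpa using h0, by simp, fun j => ?_,
      fun j hj => ?_⟩
    · dsimp only
      split_ifs
      exacts [hqV j, huv.1]
    · rcases (Nat.lt_succ_iff.1 hj).lt_or_eq with h | rfl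
      · simpa [h.le, Nat.succ_le_of_lt h] using hq j h
      · simpa [hk] using huv.2.2

/-- A finite chain of linked points can be refined to a chain of more closely linked points. -/
theorem exists_linked_refinement [LocallyConnectedSpace Y] {ε δ : ℝ} (hδ : 0 < δ)
    {n : ℕ} {p : ℕ → Y} (hp : ∀ i < n, Linked ε (p i) (p (i + 1))) (hε : 0 ≤ ε) :
    ∃ m > 0, ∃ q : ℕ → Y, q 0 = p 0 ∧ q (n * m) = p n ∧
      (∀ j < n * m, Linked δ (q j) (q (j + 1))) ∧ ∀ j, dist (q j) (p (j / m)) ≤ ε := by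
  have key : ∀ i < n, ∃ M : ℕ, ∀ m ≥ M, ∃ q : ℕ → Y, q 0 = p i ∧ q m = p (i + 1) ∧
      (∀ j, dist (q j) (p i) ≤ ε) ∧ ∀ j < m, Linked δ (q j) (q (j + 1)) := by
    intro i hi
    obtain ⟨W, -, hc, hu, hv, hd⟩ := hp i hi
    obtain ⟨M, hM⟩ := hc.exists_linked_chain hδ hu hv
    refine ⟨M, fun m hm => ?_⟩
    obtain ⟨q, h0, hm, hqW, hq⟩ := hM m hm
    exact ⟨q, h0, hm, fun j => hd _ (hqW j) _ hu, hq⟩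
  choose! M hM using key
  set m := (Finset.range n).sup M + 1
  have key : ∀ i, ∃ q : ℕ → Y, q 0 = p i ∧ (i < n → q m = p (i + 1)) ∧
      (∀ j, dist (q j) (p i) ≤ ε) ∧ (i < n → ∀ j < m, Linked δ (q j) (q (j + 1))) := by
    intro i
    by_cases hi : i < n
    · obtain ⟨q, h0, hm, hd, hq⟩ := hM i hi m
        ((Finset.le_sup (f := M) (Finset.mem_range.2 hi)).trans (Nat.le_succ _))
      exact ⟨q, h0, fun _ => hm, hd, fun _ => hq⟩
    · exact ⟨fun _ => p i, rfl, fun h => absurd h hi, fun _ => by simpa using hε,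
        fun h => absurd h hi⟩
  choose q hq0 hqm hqd hql using key
  have hm0 : 0 < m := Nat.succ_pos _
  refine ⟨m, hm0, fun j => q (j / m) (j % m), by simp [hq0], by simp [hq0], fun j hj => ?_,
    fun j => hqd _ _⟩
  have hjn : j / m < n := (Nat.div_lt_iff_lt_mul hm0).2 hj
  have hlink := hql _ hjn (j % m) (Nat.mod_lt _ hm0)
  have hj' := Nat.div_add_mod j m
  rcases (Nat.succ_le_of_lt (Nat.mod_lt j hm0)).lt_or_eq with h | h
  · have hdiv : (j + 1) / m = j / m := by
      rw [Nat.div_eq_iff hm0, mul_comm]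
      omega
    have hmod : (j + 1) % m = j % m + 1 := by
      have := Nat.div_add_mod (j + 1) m
      rw [hdiv] at this
      omega
    simpa only [hdiv, hmod] using hlink
  · have hj1 : j + 1 = m * (j / m + 1) := by
      rw [mul_add, mul_one]; omega
    have hdiv : (j + 1) / m = j / m + 1 := by rw [hj1, Nat.mul_div_cancel_left _ hm0]
    have hmod : (j + 1) % m = 0 := by rw [hj1, Nat.mul_mod_right]
    simp only [hdiv, hmod, hq0]
    have h' : j % m + 1 = m := h
    rwa [h', hqm _ hjn] at hlink

theorem floor_eq_or_adjacent_of_abs_sub_lt_one {a b : ℝ} (hab : |a - b| < 1) :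
    ⌊a⌋₊ = ⌊b⌋₊ ∨ ⌊a⌋₊ = ⌊b⌋₊ + 1 ∨ ⌊b⌋₊ = ⌊a⌋₊ + 1 := by
  have h := abs_lt.1 hab
  have h₁ : ⌊a⌋₊ ≤ ⌊b⌋₊ + 1 := by
    rw [← Nat.lt_succ_iff, Nat.floor_lt' (by simp)]
    push_cast
    linarith [Nat.lt_floor_add_one b]
  have h₂ : ⌊b⌋₊ ≤ ⌊a⌋₊ + 1 := by
    rw [← Nat.lt_succ_iff, Nat.floor_lt' (by simp)]
    push_cast
    linarith [Nat.lt_floor_add_one a]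
  omega

/-- A complete, connected, locally connected metric space is path connected. -/
theorem joined_of_complete_locallyConnected [CompleteSpace Y] [PreconnectedSpace Y]
    [LocallyConnectedSpace Y] (a b : Y) : Joined a b := by
  let Chain (k : ℕ) := {c : ℕ × (ℕ → Y) // 0 < c.1 ∧ c.2 0 = a ∧ c.2 c.1 = b ∧
    ∀ i < c.1, Linked ((1 / 2 : ℝ) ^ k) (c.2 i) (c.2 (i + 1))}
  have hinit : Nonempty (Chain 0) := by
    obtain ⟨M, hM⟩ := isPreconnected_univ.exists_linked_chain (ε := (1 / 2 : ℝ) ^ 0) (by norm_num)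
      (mem_univ a) (mem_univ b)
    obtain ⟨q, h0, hm, -, hq⟩ := hM (M + 1) (Nat.le_succ _)
    exact ⟨⟨(M + 1, q), Nat.succ_pos _, h0, hm, hq⟩⟩
  have hstep : ∀ k (c : Chain k), ∃ d : Chain (k + 1), ∃ m > 0, d.1.1 = c.1.1 * m ∧
      ∀ j, dist (d.1.2 j) (c.1.2 (j / m)) ≤ (1 / 2 : ℝ) ^ k := by
    rintro k ⟨⟨n, p⟩, hn, h0, hpn, hp⟩
    obtain ⟨m, hm, q, hq0, hqn, hq, hd⟩ :=
      exists_linked_refinement (δ := (1 / 2 : ℝ) ^ (k + 1)) (by positivity) hp (by positivity)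
    exact ⟨⟨(n * m, q), Nat.mul_pos hn hm, hq0.trans h0, hqn.trans hpn, hq⟩, m, hm, rfl, hd⟩
  choose next mul hmul hnext hdist using hstep
  let c : ∀ k, Chain k := fun k => Nat.rec hinit.some (fun k c => next k c) k
  let F : ℕ → unitInterval → Y := fun k t => (c k).1.2 ⌊(t : ℝ) * (c k).1.1⌋₊
  have hF : ∀ t k, dist (F k t) (F (k + 1) t) ≤ 1 * (1 / 2 : ℝ) ^ k := by
    intro t k
    have h := hdist k (c k) ⌊(t : ℝ) * (c (k + 1)).1.1⌋₊
    have hm : (mul k (c k) : ℝ) ≠ 0 := by exact_mod_cast (hmul k (c k)).ne'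
    have hfl : ⌊(t : ℝ) * (c (k + 1)).1.1⌋₊ / mul k (c k) = ⌊(t : ℝ) * (c k).1.1⌋₊ := by
      rw [← Nat.floor_div_natCast, show (c (k + 1)).1.1 = (c k).1.1 * mul k (c k) from
        hnext k (c k), Nat.cast_mul, ← mul_assoc, mul_div_assoc, div_self hm, mul_one]
    rw [hfl] at h
    rw [dist_comm, one_mul]
    exact h
  have hlim : ∀ t, ∃ y, Tendsto (fun k => F k t) atTop (𝓝 y) := fun t =>
    cauchySeq_tendsto_of_complete (cauchySeq_of_le_geometric _ _ (by norm_num) (hF t))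
  choose γ hγ using hlim
  have hFγ : ∀ t k, dist (F k t) (γ t) ≤ 2 * (1 / 2 : ℝ) ^ k := by
    intro t k
    have := dist_le_of_le_geometric_of_tendsto (1 / 2 : ℝ) 1 (by norm_num) (hF t) (hγ t) k
    norm_num at this ⊢
    linarith
  have hcont : Continuous γ := by
    refine Metric.continuous_iff.2 fun t ε hε => ?_
    obtain ⟨k, hk⟩ := exists_pow_lt_of_lt_one (show (0 : ℝ) < ε / 5 by positivity)
      (show (1 / 2 : ℝ) < 1 by norm_num)
    have hn : (0 : ℝ) < (c k).1.1 := by exact_mod_cast (c k).2.1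
    refine ⟨1 / (c k).1.1, by positivity, fun s hs => ?_⟩
    have hle : ∀ r : unitInterval, ⌊(r : ℝ) * (c k).1.1⌋₊ ≤ (c k).1.1 := fun r =>
      Nat.floor_le_of_le (mul_le_of_le_one_left hn.le r.2.2)
    have hst : |(s : ℝ) * (c k).1.1 - t * (c k).1.1| < 1 := by
      rw [← sub_mul, abs_mul, abs_of_pos hn, ← lt_div_iff₀ hn]
      exact hs
    have hFst : dist (F k s) (F k t) ≤ (1 / 2 : ℝ) ^ k := by
      rcases floor_eq_or_adjacent_of_abs_sub_lt_one hst with h | h | h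
      · simp only [F, h, dist_self]; positivity
      · simp only [F, h]
        rw [dist_comm]
        exact ((c k).2.2.2.2 _ (by have := hle s; omega)).dist_le
      · simp only [F, h]
        exact ((c k).2.2.2.2 _ (by have := hle t; omega)).dist_le
    have h₁ := hFγ s k
    have h₂ := hFγ t k
    rw [dist_comm] at h₁
    linarith [dist_triangle4 (γ s) (F k s) (F k t) (γ t)]
  refine ⟨⟨⟨γ, hcont⟩, ?_, ?_⟩⟩
  · exact tendsto_nhds_unique (hγ 0) (by simp [F, (c _).2.2.1])
  · exact tendsto_nhds_unique (hγ 1) (by simp [F, (c _).2.2.2.1])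

/-- Connected open sets in a complete locally connected metric space are path connected. -/
theorem IsOpen.joinedIn_of_isPreconnected [CompleteSpace Y] [LocallyConnectedSpace Y]
    {U : Set Y} (hU : IsOpen U) (hc : IsPreconnected U) {a b : Y} (ha : a ∈ U) (hb : b ∈ U) :
    JoinedIn U a b := by
  let V : TopologicalSpace.Opens Y := ⟨U, hU⟩
  have : PreconnectedSpace V.CompleteCopy := isPreconnected_iff_preconnectedSpace.1 hc
  have : LocallyConnectedSpace V.CompleteCopy := hU.locallyConnectedSpace
  have h : Joined (X := V.CompleteCopy) ⟨a, ha⟩ ⟨b, hb⟩ := joined_of_complete_locallyConnected _ _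
  exact joinedIn_iff_joined ha hb |>.2 h

end PathConnected

section Arc

open unitInterval

variable {X : Type*}

/-- A closed set of parameters containing the endpoints such that `γ` takes equal values at the
two ends of every complementary gap. -/
structure IsSkeleton (γ : I → X) (K : Set I) : Prop where
  isClosed : IsClosed K
  zero_mem : 0 ∈ K
  one_mem : 1 ∈ K
  eq_of_gap : ∀ s ∈ K, ∀ t ∈ K, s < t → (∀ u ∈ K, s < u → t ≤ u) → γ s = γ t

theorem IsSkeleton.exists_gap {γ : I → X} {K : Set I} (hK : IsSkeleton γ K) (r : I) :
    ∃ s t, IsGreatest (K ∩ Iic r) s ∧ IsLeast (K ∩ Ici r) t ∧ γ s = γ t := by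
  obtain ⟨s, hs⟩ := (hK.isClosed.inter isClosed_Iic).isCompact.exists_isGreatest
    ⟨0, hK.zero_mem, (nonneg' : 0 ≤ r)⟩
  obtain ⟨t, ht⟩ := (hK.isClosed.inter isClosed_Ici).isCompact.exists_isLeast
    ⟨1, hK.one_mem, (le_one' : r ≤ 1)⟩
  refine ⟨s, t, hs, ht, ?_⟩
  have hst : s ≤ t := hs.1.2.trans ht.1.2
  rcases hst.eq_or_lt with rfl | hlt
  · rfl
  refine hK.eq_of_gap s hs.1.1 t ht.1.1 hlt fun u hu hsu => ht.2 ⟨hu, ?_⟩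
  by_contra hur
  exact hsu.not_ge (hs.2 ⟨hu, mem_Iic.2 (not_le.1 hur).le⟩)

theorem IsSkeleton.remove_loop {γ : I → X} {K : Set I} (hK : IsSkeleton γ K) {x y : I}
    (hx : x ∈ K) (hy : y ∈ K) (hxy : γ x = γ y) : IsSkeleton γ (K ∩ (Iic x ∪ Ici y)) := by
  rcases le_or_gt y x with hle | hlt
  · have : Iic x ∪ Ici y = univ := Iic_union_Ici_of_le hle
    rwa [this, inter_univ]
  refine ⟨hK.isClosed.inter (isClosed_Iic.union isClosed_Ici), ⟨hK.zero_mem, Or.inl nonneg'⟩,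
    ⟨hK.one_mem, Or.inr le_one'⟩, fun s hs t ht hst hgap => ?_⟩
  by_cases hgap' : ∀ u ∈ K, s < u → t ≤ u
  · exact hK.eq_of_gap s hs.1 t ht.1 hst hgap'
  push Not at hgap'
  obtain ⟨u, hu, hsu, hut⟩ := hgap'
  have hu' : x < u ∧ u < y := by
    by_contra h
    exact hut.not_ge (hgap u ⟨hu, by simp only [mem_union, mem_Iic, mem_Ici]; grind⟩ hsu)
  have hsx : s ≤ x := hs.2.resolve_right fun h => (hsu.trans hu'.2).not_ge h
  have hyt : y ≤ t := ht.2.resolve_left fun h => (hu'.1.trans hut).not_ge h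
  have h₁ : s = x := le_antisymm hsx
    (not_lt.1 fun h => (hgap x ⟨hx, Or.inl self_mem_Iic⟩ h).not_gt (hu'.1.trans hut))
  have h₂ : t = y := le_antisymm (hgap y ⟨hy, Or.inr self_mem_Ici⟩ (hsu.trans hu'.2)) hyt
  rw [h₁, h₂, hxy]

variable [MetricSpace X]

theorem isSkeleton_sInter {γ : I → X} (hγ : Continuous γ) {c : Set (Set I)}
    (hc : ∀ K ∈ c, IsSkeleton γ K) (hchain : IsChain (· ⊆ ·) c) (hne : c.Nonempty) :
    IsSkeleton γ (⋂₀ c) := by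
  refine ⟨isClosed_sInter fun K hK => (hc K hK).isClosed, fun K hK => (hc K hK).zero_mem,
    fun K hK => (hc K hK).one_mem, fun s hs t ht hst hgap => ?_⟩
  obtain ⟨r, hsr, hrt⟩ := exists_between hst
  let A : c → Set (I × I) := fun K =>
    ((K.1 ∩ Icc s r) ×ˢ (K.1 ∩ Icc r t)) ∩ {z | γ z.1 = γ z.2}
  have hAcl : ∀ K, IsClosed (A K) := fun K =>
    (((hc _ K.2).isClosed.inter isClosed_Icc).prod ((hc _ K.2).isClosed.inter isClosed_Icc)).inter
      (isClosed_eq (by fun_prop) (by fun_prop))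
  have : Nonempty c := hne.to_subtype
  have hdir : Directed (· ⊇ ·) A := fun K L => by
    rcases hchain.total K.2 L.2 with h | h
    · exact ⟨K, subset_rfl, fun z hz => ⟨⟨⟨h hz.1.1.1, hz.1.1.2⟩, h hz.1.2.1, hz.1.2.2⟩, hz.2⟩⟩
    · exact ⟨L, fun z hz => ⟨⟨⟨h hz.1.1.1, hz.1.1.2⟩, h hz.1.2.1, hz.1.2.2⟩, hz.2⟩, subset_rfl⟩
  have hAne : ∀ K, (A K).Nonempty := fun K => by
    obtain ⟨u, v, hu, hv, huv⟩ := (hc _ K.2).exists_gap r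
    exact ⟨(u, v), ⟨⟨hu.1.1, hu.2 ⟨hs K.1 K.2, hsr.le⟩, hu.1.2⟩, hv.1.1, hv.1.2,
      hv.2 ⟨ht K.1 K.2, hrt.le⟩⟩, huv⟩
  obtain ⟨⟨s', t'⟩, h⟩ := IsCompact.nonempty_iInter_of_directed_nonempty_isCompact_isClosed A
    hdir hAne (fun K => (hAcl K).isCompact) hAcl
  rw [mem_iInter] at h
  have hs' : s' ∈ ⋂₀ c := fun K hK => (h ⟨K, hK⟩).1.1.1
  have ht' : t' ∈ ⋂₀ c := fun K hK => (h ⟨K, hK⟩).1.2.1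
  obtain ⟨⟨⟨-, hs₁, hs₂⟩, -, ht₁, ht₂⟩, heq⟩ := h ⟨_, hne.some_mem⟩
  have h₁ : s' = s := le_antisymm
    (not_lt.1 fun hlt => (hgap s' hs' hlt).not_gt (hs₂.trans_lt hrt)) hs₁
  have h₂ : t' = t := le_antisymm ht₂ (hgap t' ht' (hsr.trans_le ht₁))
  rwa [mem_ofPred_eq, h₁, h₂] at heq

/-- Loop erasure: a path can be replaced by one with the same endpoints all of whose fibres are
intervals. -/
theorem exists_path_ordConnected_fibers {γ : I → X} (hγ : Continuous γ) :
    ∃ η : I → X, Continuous η ∧ η 0 = γ 0 ∧ η 1 = γ 1 ∧ range η ⊆ range γ ∧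
      ∀ s t, η s = η t → ∀ u ∈ Icc s t, η u = η s := by
  obtain ⟨K, -, hK⟩ := zorn_superset_nonempty {K | IsSkeleton γ K}
    (fun c hc hchain hne =>
      ⟨⋂₀ c, isSkeleton_sInter hγ hc hchain hne, fun K hK => sInter_subset_of_mem hK⟩)
    univ ⟨isClosed_univ, mem_univ _, mem_univ _, fun s _ t _ hst hgap => by
      obtain ⟨r, hsr, hrt⟩ := exists_between hst
      exact absurd (hgap r (mem_univ _) hsr) hrt.not_ge⟩
  have hsk : IsSkeleton γ K := hK.prop
  choose lo hi hlo hhi hlohi using hsk.exists_gap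
  have hfix : ∀ t ∈ K, lo t = t := fun t ht => le_antisymm (hlo t).1.2 ((hlo t).2 ⟨ht, self_mem_Iic⟩)
  have hmono : Monotone lo := fun s t hst => (hlo t).2 ⟨(hlo s).1.1, (hlo s).1.2.trans hst⟩
  have hloop : ∀ x ∈ K, ∀ y ∈ K, γ x = γ y → ∀ u ∈ K, u ≤ x ∨ y ≤ u := fun x hx y hy hxy u hu =>
    (hK.le_of_le (hsk.remove_loop hx hy hxy) inter_subset_left hu).2
  refine ⟨γ ∘ lo, ?_, by simp [hfix 0 hsk.zero_mem], by simp [hfix 1 hsk.one_mem],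
    range_comp_subset_range _ _, fun s t hst u hu => ?_⟩
  · have key : ∀ s t, s ≤ t → γ (lo s) = γ (lo t) ∨
        ∃ s' ∈ Icc s t, ∃ t' ∈ Icc s t, γ (lo s) = γ s' ∧ γ (lo t) = γ t' := by
      intro s t hst
      rcases le_or_gt (hi s) t with h | h
      · exact Or.inr ⟨hi s, ⟨(hhi s).1.2, h⟩, lo t,
          ⟨le_trans (hhi s).1.2 ((hlo t).2 ⟨(hhi s).1.1, h⟩), (hlo t).1.2⟩, hlohi s, rfl⟩
      · refine Or.inl (congrArg γ (le_antisymm (hmono hst) ((hlo s).2 ⟨(hlo t).1.1, ?_⟩)))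
        by_contra hs
        exact h.not_ge (((hhi s).2 ⟨(hlo t).1.1, mem_Ici.2 (not_le.1 hs).le⟩).trans (hlo t).1.2)
    have huc := Metric.uniformContinuous_iff.1 (CompactSpace.uniformContinuous_of_continuous hγ)
    refine Metric.continuous_iff.2 fun t ε hε => ?_
    obtain ⟨δ, hδ, h⟩ := huc ε hε
    have hle : ∀ s t : I, s ≤ t → dist s t < δ → dist (γ (lo s)) (γ (lo t)) < ε := by
      intro s t hst hd
      rcases key s t hst with heq | ⟨s', hs', t', ht', h₁, h₂⟩
      · rwa [heq, dist_self]
      · rw [h₁, h₂]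
        refine h (lt_of_le_of_lt ?_ hd)
        rw [Subtype.dist_eq, Subtype.dist_eq, dist_comm (s : ℝ), Real.dist_eq, Real.dist_eq,
          abs_of_nonneg (sub_nonneg.2 (Subtype.coe_le_coe.2 hst)), abs_le]
        have := Subtype.coe_le_coe.2 hs'.1
        have := Subtype.coe_le_coe.2 hs'.2
        have := Subtype.coe_le_coe.2 ht'.1
        have := Subtype.coe_le_coe.2 ht'.2
        constructor <;> linarith
    refine ⟨δ, hδ, fun s hs => ?_⟩
    rcases le_total s t with h' | h'
    · exact hle s t h' hs
    · rw [dist_comm] at hs ⊢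
      exact hle t s h' hs
  · rcases hloop _ (hlo s).1.1 _ (hlo t).1.1 hst _ (hlo u).1.1 with h | h
    · exact congrArg γ (le_antisymm h (hmono hu.1))
    · exact (congrArg γ (le_antisymm (hmono hu.2) h)).trans hst.symm

/-- How far `γ` travels from `γ p` during the parameter interval `[p, t]`. -/
noncomputable def excursion (γ : I → X) (p t : I) : ℝ :=
  sSup ((fun u => dist (γ (max p (min u t))) (γ p)) '' univ)

theorem continuous_excursion {γ : I → X} (hγ : Continuous γ) (p : I) :
    Continuous (excursion γ p) :=
  isCompact_univ.continuous_sSup (f := fun t u => dist (γ (max p (min u t))) (γ p))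
    (by unfold Function.HasUncurry.uncurry; fun_prop)

theorem dist_le_excursion {γ : I → X} (hγ : Continuous γ) (p u t : I) :
    dist (γ (max p (min u t))) (γ p) ≤ excursion γ p t :=
  le_csSup (isCompact_univ.image (by fun_prop)).bddAbove ⟨u, mem_univ _, rfl⟩

theorem excursion_le {γ : I → X} {p t : I} {C : ℝ}
    (h : ∀ u, dist (γ (max p (min u t))) (γ p) ≤ C) : excursion γ p t ≤ C :=
  csSup_le (univ_nonempty.image _) (by rintro - ⟨u, -, rfl⟩; exact h u)

theorem excursion_nonneg {γ : I → X} (hγ : Continuous γ) (p t : I) : 0 ≤ excursion γ p t :=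
  dist_nonneg.trans (dist_le_excursion hγ p 0 t)

theorem monotone_excursion {γ : I → X} (hγ : Continuous γ) (p : I) :
    Monotone (excursion γ p) := fun s t hst => excursion_le fun u => by
  have := dist_le_excursion hγ p (min u s) t
  rwa [min_assoc, min_eq_left hst] at this

theorem excursion_eq {γ : I → X} (hγ : Continuous γ)
    (hfib : ∀ s t, γ s = γ t → ∀ u ∈ Icc s t, γ u = γ s) {s t : I} (hst : s ≤ t)
    (h : γ s = γ t) (p : I) : excursion γ p s = excursion γ p t := by
  refine le_antisymm (monotone_excursion hγ p hst) (excursion_le fun u => ?_)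
  rcases le_or_gt u s with hu | hu
  · have := dist_le_excursion hγ p u s
    rwa [min_eq_left hu, ← min_eq_left (hu.trans hst)] at this
  have hw : min u t ∈ Icc s t := ⟨le_min hu.le hst, min_le_right _ _⟩
  rcases le_total (min u t) p with hp | hp
  · rw [max_eq_left hp, dist_self]
    exact excursion_nonneg hγ p s
  rw [max_eq_right hp, hfib s t h _ hw]
  rcases le_total p s with hps | hps
  · simpa [hps] using dist_le_excursion hγ p s s
  · rw [hfib s t h p ⟨hps, hp.trans hw.2⟩, dist_self]
    exact excursion_nonneg hγ p s

/-- A path with interval fibres factors through a monotone map of the interval whose fibres are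
exactly those of the path. -/
theorem exists_collapse {γ : I → X} (hγ : Continuous γ) (hne : γ 0 ≠ γ 1)
    (hfib : ∀ s t, γ s = γ t → ∀ u ∈ Icc s t, γ u = γ s) :
    ∃ Φ : I → I, Continuous Φ ∧ Φ 0 = 0 ∧ Φ 1 = 1 ∧ ∀ s t, Φ s = Φ t ↔ γ s = γ t := by
  obtain ⟨C, hC⟩ := Metric.isBounded_iff.1 (isCompact_range hγ).isBounded
  have hle : ∀ p t, excursion γ p t ≤ C := fun p t =>
    excursion_le fun u => hC (mem_range_self _) (mem_range_self _)
  let q := TopologicalSpace.denseSeq I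
  let φ : I → ℝ := fun t => ∑' n, (1 / 2 : ℝ) ^ n * excursion γ (q n) t
  have hbound : ∀ n t, ‖(1 / 2 : ℝ) ^ n * excursion γ (q n) t‖ ≤ (1 / 2 : ℝ) ^ n * C := by
    intro n t
    rw [Real.norm_of_nonneg (mul_nonneg (by positivity) (excursion_nonneg hγ _ _))]
    exact mul_le_mul_of_nonneg_left (hle _ _) (by positivity)
  have hgeom : Summable fun n : ℕ => (1 / 2 : ℝ) ^ n * C := summable_geometric_two.mul_right C
  have hsum : ∀ t, Summable fun n => (1 / 2 : ℝ) ^ n * excursion γ (q n) t := fun t =>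
    Summable.of_norm_bounded hgeom fun n => hbound n t
  have hφ : Continuous φ := continuous_tsum
    (fun n => continuous_const.mul (continuous_excursion hγ _)) hgeom hbound
  have hmono : Monotone φ := fun s t hst => Summable.tsum_le_tsum
    (fun n => mul_le_mul_of_nonneg_left (monotone_excursion hγ _ hst) (by positivity))
    (hsum s) (hsum t)
  have hlt : ∀ s t, s ≤ t → γ s ≠ γ t → φ s < φ t := by
    intro s t hst hγst
    have hopen : IsOpen {u | γ u ≠ γ t} := isOpen_ne_fun hγ continuous_const
    have hst' : s < t := hst.lt_of_ne fun h => hγst (congrArg γ h)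
    obtain ⟨v, hv, hsub⟩ := (mem_nhdsGE_iff_exists_Ico_subset' hst').1
      (mem_nhdsWithin_of_mem_nhds (hopen.mem_nhds hγst))
    obtain ⟨n, hsp, hpv⟩ := (TopologicalSpace.denseRange_denseSeq I).exists_mem_open
      (isOpen_Ioo (a := s) (b := min v t)) (nonempty_Ioo.2 (lt_min hv hst'))
    refine Summable.tsum_lt_tsum (i := n)
      (fun n => mul_le_mul_of_nonneg_left (monotone_excursion hγ _ hst) (by positivity))
      (mul_lt_mul_of_pos_left ?_ (by positivity)) (hsum s) (hsum t)
    have h₀ : excursion γ (q n) s ≤ 0 := excursion_le fun u => by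
      rw [max_eq_left ((min_le_right _ _).trans hsp.le), dist_self]
    have h₁ := dist_le_excursion hγ (q n) t t
    rw [min_self, max_eq_right (hpv.le.trans (min_le_right _ _))] at h₁
    exact h₀.trans_lt ((dist_pos.2 (Ne.symm (hsub ⟨hsp.le, hpv.trans_le (min_le_left _ _)⟩))).trans_le
      h₁)
  have hiff : ∀ s t, s ≤ t → (φ s = φ t ↔ γ s = γ t) := fun s t hst =>
    ⟨fun h => by_contra fun hne => (hlt s t hst hne).ne h, fun h => by
      simp only [φ, excursion_eq hγ hfib hst h]⟩
  have h01 : 0 < φ 1 - φ 0 := sub_pos.2 (hlt 0 1 nonneg' hne)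
  refine ⟨fun t => ⟨(φ t - φ 0) / (φ 1 - φ 0), div_nonneg (sub_nonneg.2 (hmono nonneg')) h01.le,
    (div_le_one h01).2 (sub_le_sub_right (hmono le_one') _)⟩, by fun_prop, by ext; simp,
    by ext; simp [h01.ne'], fun s t => ?_⟩
  rw [Subtype.ext_iff]
  dsimp only
  rw [div_left_inj' h01.ne', sub_left_inj]
  rcases le_total s t with h | h
  · exact hiff s t h
  · rw [eq_comm, hiff t s h, eq_comm]

/-- Two distinct points joined by a path are joined by an injective path. -/
theorem Path.exists_injective {a b : X} (γ : Path a b) (hab : a ≠ b) :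
    ∃ α : Path a b, Function.Injective α ∧ range α ⊆ range γ := by
  obtain ⟨η, hη, hη0, hη1, hηγ, hfib⟩ := exists_path_ordConnected_fibers γ.continuous
  rw [γ.source] at hη0
  rw [γ.target] at hη1
  obtain ⟨Φ, hΦ, hΦ0, hΦ1, hΦη⟩ := exists_collapse hη (by rwa [hη0, hη1]) hfib
  have hsurj : Function.Surjective Φ := fun r =>
    mem_range_of_exists_le_of_exists_ge hΦ ⟨0, hΦ0.trans_le nonneg'⟩ ⟨1, le_one'.trans_eq hΦ1.symm⟩
  choose ψ hψ using hsurj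
  have hcomp : (η ∘ ψ) ∘ Φ = η := funext fun t => (hΦη _ _).1 (hψ _)
  have hcont : Continuous (η ∘ ψ) :=
    (hΦ.isClosedMap.isQuotientMap hΦ fun r => ⟨ψ r, hψ r⟩).continuous_iff.2
      (by rwa [hcomp])
  refine ⟨⟨⟨η ∘ ψ, hcont⟩, ?_, ?_⟩, fun s t hst => ?_, ?_⟩
  · have := congrFun hcomp 0
    simp only [Function.comp_apply, hΦ0] at this
    exact this.trans hη0
  · have := congrFun hcomp 1
    simp only [Function.comp_apply, hΦ1] at this
    exact this.trans hη1
  · rw [← hψ s, ← hψ t]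
    exact (hΦη _ _).2 hst
  · exact (range_comp_subset_range ψ η).trans hηγ

/-- Two injective paths that meet only at their common endpoints form a simple closed curve. -/
theorem exists_circle_of_paths {a b : X} {α β : Path a b} (hα : Function.Injective α)
    (hβ : Function.Injective β) (hdisj : ∀ s t, α s = β t → s = 0 ∨ s = 1) :
    ∃ c : Circle → X, Continuous c ∧ Function.Injective c := by
  let ℓ := (α.trans β.symm).extend
  have : Fact ((0 : ℝ) < 1) := ⟨one_pos⟩
  have hcont : Continuous (AddCircle.liftIco (1 : ℝ) 0 ℓ) :=
    AddCircle.liftIco_zero_continuous (by simp [ℓ]) (Path.continuous_extend _).continuousOn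
  have hleft : ∀ x (hx : x ∈ Ico (0 : ℝ) 1) (h : x ≤ 1 / 2),
      ℓ x = α ⟨2 * x, by linarith [hx.1], by linarith⟩ := fun x hx h => by
    simp only [ℓ]
    rw [Path.extend_apply _ ⟨hx.1, hx.2.le⟩, Path.trans_apply, dif_pos h]
  have hright : ∀ x (hx : x ∈ Ico (0 : ℝ) 1) (h : 1 / 2 < x),
      ℓ x = β ⟨2 - 2 * x, by linarith [hx.2], by linarith⟩ := fun x hx h => by
    simp only [ℓ]
    rw [Path.extend_apply _ ⟨hx.1, hx.2.le⟩, Path.trans_apply, dif_neg (not_le.2 h),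
      Path.symm_apply]
    refine congrArg β (Subtype.ext ?_)
    simp only [coe_symm_eq]
    ring
  have hinj : ∀ x ∈ Ico (0 : ℝ) 1, ∀ y ∈ Ico (0 : ℝ) 1, x ≤ y → ℓ x = ℓ y → x = y := by
    intro x hx y hy hxy h
    rcases le_or_gt y (1 / 2) with hy' | hy'
    · rw [hleft x hx (hxy.trans hy'), hleft y hy hy'] at h
      have := Subtype.ext_iff.1 (hα h)
      dsimp only at this
      linarith
    rcases le_or_gt x (1 / 2) with hx' | hx'
    · rw [hleft x hx hx', hright y hy hy'] at h
      rcases hdisj _ _ h with h' | h'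
      · rw [h', α.source] at h
        have := Subtype.ext_iff.1 (hβ (β.source.trans h))
        simp only [Icc.coe_zero] at this
        linarith [hy.2]
      · rw [h', α.target] at h
        have := Subtype.ext_iff.1 (hβ (β.target.trans h))
        simp only [Icc.coe_one] at this
        linarith
    · rw [hright x hx hx', hright y hy hy'] at h
      have := Subtype.ext_iff.1 (hβ h)
      dsimp only at this
      linarith
  refine ⟨AddCircle.liftIco (1 : ℝ) 0 ℓ ∘ (AddCircle.homeomorphCircle one_ne_zero).symm,
    hcont.comp (Homeomorph.continuous _), Function.Injective.comp ?_ (Homeomorph.injective _)⟩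
  intro z w hzw
  obtain ⟨x, hx, rfl⟩ := (AddCircle.coe_image_Ico_eq (1 : ℝ) 0).symm ▸ mem_univ z
  obtain ⟨y, hy, rfl⟩ := (AddCircle.coe_image_Ico_eq (1 : ℝ) 0).symm ▸ mem_univ w
  rw [zero_add] at hx hy
  rw [AddCircle.liftIco_zero_coe_apply hx, AddCircle.liftIco_zero_coe_apply hy] at hzw
  rcases le_total x y with h | h
  · rw [hinj x hx y hy h hzw]
  · rw [hinj y hy x hx h hzw.symm]

/-- If an arc can be bypassed at an interior point, the space contains a simple closed curve. -/
theorem exists_circle_of_bypass {a b : X} {α : Path a b} (hα : Function.Injective α) {t₀ : I}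
    {h : Path a b} (hh : ∀ s, h s ≠ α t₀) : ∃ c : Circle → X, Continuous c ∧ Function.Injective c := by
  have hcl : ∀ S : Set I, IsClosed S → IsClosed (h ⁻¹' (α '' S)) := fun S hS =>
    (hS.isCompact.image α.continuous).isClosed.preimage h.continuous
  obtain ⟨s₁, ⟨u, hu, hus⟩, hs₁⟩ := (hcl _ (isClosed_Iic (a := t₀))).isCompact.exists_isGreatest
    ⟨0, 0, mem_Iic.2 nonneg', by simp⟩
  obtain ⟨s₂, ⟨⟨v, hv, hvs⟩, hs₁₂⟩, hs₂⟩ :=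
    ((hcl _ (isClosed_Ici (a := t₀))).inter (isClosed_Ici (a := s₁))).isCompact.exists_isLeast
      ⟨1, ⟨1, mem_Ici.2 le_one', by simp⟩, mem_Ici.2 le_one'⟩
  have hut : u < t₀ := lt_of_le_of_ne hu fun h' => hh s₁ (by rw [← hus, h'])
  have htv : t₀ < v := lt_of_le_of_ne hv fun h' => hh s₂ (by rw [← hvs, h'])
  have hne : α u ≠ α v := fun h' => (hut.trans htv).ne (hα h')
  have hmeet : ∀ s ∈ Icc s₁ s₂, ∀ t, h s = α t → s = s₁ ∨ s = s₂ := by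
    intro s hs t hst
    rcases le_total t t₀ with ht | ht
    · exact Or.inl (le_antisymm (hs₁ ⟨t, ht, hst.symm⟩) hs.1)
    · exact Or.inr (le_antisymm hs.2 (hs₂ ⟨⟨t, ht, hst.symm⟩, hs.1⟩))
  obtain ⟨β, hβ, hβr⟩ := (α.subpath u v).exists_injective hne
  obtain ⟨κ, hκ, hκr⟩ := ((h.subpath s₁ s₂).cast hus hvs).exists_injective hne
  refine exists_circle_of_paths hβ hκ fun s t hst => ?_
  obtain ⟨r, -, hr⟩ : β s ∈ α '' uIcc u v := Path.range_subpath α u v ▸ hβr (mem_range_self s)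
  obtain ⟨w, hw, hw'⟩ : κ t ∈ h '' uIcc s₁ s₂ :=
    Path.range_subpath h s₁ s₂ ▸ hκr (mem_range_self t)
  rw [uIcc_of_le hs₁₂] at hw
  have hval : h w = β s := hw'.trans hst.symm
  rcases hmeet w hw r (hval.trans hr.symm) with rfl | rfl
  · exact Or.inl (hβ (hval.symm.trans (hus.symm.trans β.source.symm)))
  · exact Or.inr (hβ (hval.symm.trans (hvs.symm.trans β.target.symm)))

end Arc

/-- `x` lies on every connected set containing `a` and `b`. -/
def Between {Y : Type*} [TopologicalSpace Y] (a b x : Y) : Prop :=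
  ∀ C : Set Y, IsPreconnected C → a ∈ C → b ∈ C → x ∈ C

section Dendrite

variable {Y : Type*} [MetricSpace Y] [LocallyConnectedSpace Y]

/-- In a connected space, a component of the complement of a point stays connected when that
point is added to it. -/
theorem isPreconnected_insert_connectedComponentIn_s5 [PreconnectedSpace Y] {x y : Y} (hxy : y ≠ x) :
    IsPreconnected (insert x (connectedComponentIn {x}ᶜ y)) := by
  set W := connectedComponentIn {x}ᶜ y
  have hWc : IsPreconnected W := isPreconnected_connectedComponentIn
  have hyW : y ∈ W := mem_connectedComponentIn hxy
  refine hWc.subset_closure (subset_insert _ _) (insert_subset ?_ subset_closure)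
  by_contra hx
  have hsub : closure W ⊆ W := hWc.closure.subset_connectedComponentIn (subset_closure hyW)
    (subset_compl_singleton_iff.2 hx)
  have hclopen : IsClopen W :=
    ⟨isClosed_of_closure_subset hsub, isOpen_compl_singleton.connectedComponentIn⟩
  have : x ∈ W := hclopen.eq_univ ⟨y, hyW⟩ ▸ mem_univ x
  exact connectedComponentIn_subset _ _ this rfl

theorem exists_joinedIn_compl_singleton [CompleteSpace Y] {C : Set Y} (hC : IsPreconnected C)
    {a b m : Y} (ha : a ∈ C) (hb : b ∈ C) (hm : m ∉ C) : JoinedIn {m}ᶜ a b := by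
  have hsub : C ⊆ {m}ᶜ := subset_compl_singleton_iff.2 hm
  exact (isOpen_compl_singleton.connectedComponentIn.joinedIn_of_isPreconnected
    isPreconnected_connectedComponentIn (mem_connectedComponentIn (hsub ha))
    (hC.subset_connectedComponentIn ha hsub hb)).mono (connectedComponentIn_subset _ _)

/-- Points in a connected set missing `m` lie in a closed connected set missing `m`. -/
theorem exists_isClosed_isPreconnected [CompleteSpace Y] {C : Set Y} (hC : IsPreconnected C)
    {a b m : Y} (ha : a ∈ C) (hb : b ∈ C) (hm : m ∉ C) :
    ∃ J : Set Y, IsClosed J ∧ IsPreconnected J ∧ a ∈ J ∧ b ∈ J ∧ m ∉ J := by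
  obtain ⟨γ, hγ⟩ := exists_joinedIn_compl_singleton hC ha hb hm
  exact ⟨range γ, (isCompact_range γ.continuous).isClosed, isPreconnected_range γ.continuous,
    ⟨0, γ.source⟩, ⟨1, γ.target⟩, fun ⟨t, ht⟩ => hγ t ht⟩

/-- Without simple closed curves, distinct points `a`, `b` are separated by points close to `a`. -/
theorem exists_between_near [CompleteSpace Y] [PreconnectedSpace Y]
    (hY : ∀ c : Circle → Y, Continuous c → ¬ Function.Injective c) {a b : Y} (hab : a ≠ b)
    {U : Set Y} (hU : U ∈ 𝓝 a) : ∃ x ∈ U, x ≠ a ∧ Between a b x := by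
  obtain ⟨γ⟩ := joined_of_complete_locallyConnected a b
  obtain ⟨α, hα, -⟩ := γ.exists_injective hab
  have hev : ∀ᶠ t in 𝓝[>] (0 : unitInterval), α t ∈ U :=
    (α.continuous.tendsto' 0 a α.source).mono_left nhdsWithin_le_nhds hU
  have : (𝓝[>] (0 : unitInterval)).NeBot := nhdsGT_neBot_of_exists_gt ⟨1, zero_lt_one⟩
  obtain ⟨t, ht, ht0⟩ := (hev.and self_mem_nhdsWithin).exists
  refine ⟨α t, ht, fun h => ne_of_gt ht0 (hα (h.trans α.source.symm)), fun C hC ha hb => ?_⟩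
  by_contra hx
  obtain ⟨h, hh⟩ := exists_joinedIn_compl_singleton hC ha hb hx
  obtain ⟨c, hc, hci⟩ := exists_circle_of_bypass hα hh
  exact hY c hc hci

theorem isClosed_between [CompleteSpace Y] {K : Set Y} (hK : IsClosed K) {f : Y → Y}
    (hf : ContinuousOn f K) (p : Y) : IsClosed {x ∈ K | Between p (f x) x} := by
  refine isClosed_of_closure_subset fun z hz => ?_
  have hzK : z ∈ K := closure_minimal (sep_subset _ _) hK hz
  refine ⟨hzK, fun C hC hp hfz => ?_⟩
  by_contra hzC
  obtain ⟨J, hJ, hJc, hpJ, hfJ, hzJ⟩ := exists_isClosed_isPreconnected hC hp hfz hzC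
  have hne : 0 < dist (f z) z := dist_pos.2 fun h => hzC (h ▸ hfz)
  obtain ⟨V, hVsub, hVo, hfV, hVc⟩ := locallyConnectedSpace_iff_subsets_isOpen_isConnected.1
    ‹_› (f z) _ (Metric.ball_mem_nhds (f z) (half_pos hne))
  have hnear : ∀ᶠ y in 𝓝[{x ∈ K | Between p (f x) x}] z, y ∉ J ∧ dist y z < dist (f z) z / 2 ∧
      f y ∈ V :=
    (eventually_nhdsWithin_of_eventually_nhds (hJ.isOpen_compl.mem_nhds hzJ)).and
      ((eventually_nhdsWithin_of_eventually_nhds (Metric.ball_mem_nhds z (half_pos hne))).and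
        ((hf z hzK).mono_left (nhdsWithin_mono _ (sep_subset _ _)) (hVo.mem_nhds hfV)))
  have := mem_closure_iff_nhdsWithin_neBot.1 hz
  obtain ⟨y, ⟨hyJ, hyz, hyV⟩, -, hy⟩ := (hnear.and self_mem_nhdsWithin).exists
  rcases hy (J ∪ V) (hJc.union (f z) hfJ hfV hVc.isPreconnected) (Or.inl hpJ) (Or.inr hyV) with h | h
  · exact hyJ h
  · have : dist y (f z) < dist (f z) z / 2 := hVsub h
    rw [dist_comm] at this
    linarith [dist_triangle (f z) y z]

theorem isClosed_setOf_between {p x : Y} : IsClosed {y | Between p y x} := by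
  have : {y | Between p y x} = (connectedComponentIn {x}ᶜ p)ᶜ := by
    ext y
    refine ⟨fun h hy => ?_, fun h C hC hp hy => by_contra fun hx => h ?_⟩
    · have hpx : p ∈ ({x}ᶜ : Set Y) := by
        rw [← connectedComponentIn_nonempty_iff]
        exact ⟨y, hy⟩
      exact connectedComponentIn_subset _ _
        (h _ isPreconnected_connectedComponentIn (mem_connectedComponentIn hpx) hy) rfl
    · exact hC.subset_connectedComponentIn hp (subset_compl_singleton_iff.2 hx) hy
  rw [this]
  exact isOpen_compl_singleton.connectedComponentIn.isClosed_compl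

/-- The points of a closed set lying between `p` and their image have a maximal element. -/
theorem exists_maximal_between [CompactSpace Y] {K : Set Y} (hK : IsClosed K) {f : Y → Y}
    (hf : ContinuousOn f K) {p : Y} (hp : p ∈ K) :
    ∃ m ∈ K, Between p (f m) m ∧
      ∀ x ∈ K, Between p (f x) x → Between p x m → Between p m x := by
  let S := {x ∈ K | Between p (f x) x}
  have hS : IsCompact S := (isClosed_between hK hf p).isCompact
  have hpS : p ∈ S := ⟨hp, fun C _ h _ => h⟩
  have htrans : ∀ {x y z : S}, Between p y.1 x.1 → Between p z.1 y.1 → Between p z.1 x.1 :=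
    fun h₁ h₂ C hC hpC hzC => h₁ C hC hpC (h₂ C hC hpC hzC)
  have hub : ∀ c : Set S, IsChain (fun x y : S => Between p y.1 x.1) c →
      ∃ ub : S, ∀ x ∈ c, Between p ub.1 x.1 := by
    intro c hc
    rcases c.eq_empty_or_nonempty with rfl | hne
    · exact ⟨⟨p, hpS⟩, by simp⟩
    let A : c → Set Y := fun x => S ∩ {y | Between p y x.1.1}
    have hA : ∀ x, IsClosed (A x) := fun x => hS.isClosed.inter isClosed_setOf_between
    have hdir : Directed (· ⊇ ·) A := fun x y => by
      have hxy : Between p y.1.1 x.1.1 ∨ Between p x.1.1 y.1.1 := by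
        by_cases h : x.1 = y.1
        · exact Or.inl (h ▸ fun _ _ _ h => h)
        · exact hc x.2 y.2 h
      rcases hxy with h | h
      · exact ⟨y, fun z hz => ⟨hz.1, htrans (z := ⟨z, hz.1⟩) h hz.2⟩, subset_rfl⟩
      · exact ⟨x, subset_rfl, fun z hz => ⟨hz.1, htrans (z := ⟨z, hz.1⟩) h hz.2⟩⟩
    have : Nonempty c := hne.to_subtype
    obtain ⟨z, hz⟩ := IsCompact.nonempty_iInter_of_directed_nonempty_isCompact_isClosed A hdir
      (fun x => ⟨x.1.1, x.1.2, fun _ _ _ h => h⟩) (fun x => (hA x).isCompact) hA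
    rw [mem_iInter] at hz
    exact ⟨⟨z, (hz ⟨_, hne.some_mem⟩).1⟩, fun x hx => (hz ⟨x, hx⟩).2⟩
  obtain ⟨m, hm⟩ := exists_maximal_of_chains_bounded hub htrans
  exact ⟨m, m.2.1, m.2.2, fun x hxK hx => hm ⟨x, hxK, hx⟩⟩

/-- The fixed point theorem, stated inside the larger dendrite. -/
theorem exists_fixed_point_of_scrambling [CompactSpace Y] [PreconnectedSpace Y]
    (hY : ∀ c : Circle → Y, Continuous c → ¬ Function.Injective c) {K : Set Y} (hK : IsClosed K)
    (hKc : IsConnected K) {f : Y → Y} (hf : ContinuousOn f K)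
    (hscr : ∀ e ∈ closure Kᶜ ∩ K, f e ≠ e → (connectedComponentIn {e}ᶜ (f e) ∩ K).Nonempty) :
    ∃ x ∈ K, f x = x := by
  obtain ⟨p, hp⟩ := hKc.nonempty
  obtain ⟨m, hmK, hm, hmax⟩ := exists_maximal_between hK hf hp
  refine ⟨m, hmK, ?_⟩
  by_contra hfm
  have hd : 0 < dist (f m) m := dist_pos.2 hfm
  obtain ⟨V, hVsub, hVo, hfV, hVc⟩ := locallyConnectedSpace_iff_subsets_isOpen_isConnected.1
    ‹_› (f m) _ (Metric.ball_mem_nhds (f m) (half_pos hd))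
  have hK' : ∀ᶠ x in 𝓝 m, Between m (f m) x → x ∈ K := by
    by_cases hmE : m ∈ closure Kᶜ
    · obtain ⟨d, hd, hdK⟩ := hscr m ⟨hmE, hmK⟩ hfm
      obtain ⟨J, hJ, hJc, hdJ, hfJ, hmJ⟩ := exists_isClosed_isPreconnected
        isPreconnected_connectedComponentIn hd
        (mem_connectedComponentIn (show f m ∈ ({m}ᶜ : Set Y) from hfm))
        (fun h => connectedComponentIn_subset _ _ h rfl)
      filter_upwards [hJ.isOpen_compl.mem_nhds hmJ] with x hxJ hx
      exact (hx (K ∪ J) (hKc.isPreconnected.union d hdK hdJ hJc) (Or.inl hmK)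
        (Or.inr hfJ)).resolve_right hxJ
    · filter_upwards [isClosed_closure.isOpen_compl.mem_nhds hmE] with x hx _
      exact not_not.1 fun h => hx (subset_closure h)
  have hfV' : ∀ᶠ x in 𝓝 m, x ∈ K → f x ∈ V :=
    eventually_nhdsWithin_iff.1 (hf m hmK (hVo.mem_nhds hfV))
  obtain ⟨x, ⟨hxK, hxV, hxm⟩, hne, hx⟩ := exists_between_near hY (Ne.symm hfm)
    (hK'.and (hfV'.and (Metric.ball_mem_nhds m (half_pos hd))))
  replace hxK := hxK hx
  replace hxV := hxV hxK
  have hxV' : x ∉ V := fun h => by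
    have h₁ : dist x (f m) < dist (f m) m / 2 := hVsub h
    have h₂ : dist x m < dist (f m) m / 2 := hxm
    rw [dist_comm] at h₁
    linarith [dist_triangle (f m) x m]
  have hfx : Between p (f x) x := fun C hC hpC hfC => by
    have hCV : IsPreconnected (C ∪ V) := hC.union (f x) hfC hxV hVc.isPreconnected
    exact (hx _ hCV (hm _ hCV (Or.inl hpC) (Or.inr hfV)) (Or.inr hfV)).resolve_right hxV'
  have hfmx : f m ≠ x := fun h => hxV' (h ▸ hfV)
  have hmx : Between p x m := fun C hC hpC hxC => by
    set W := connectedComponentIn {x}ᶜ (f m)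
    have hfW : f m ∈ W := mem_connectedComponentIn hfmx
    have hmW : m ∉ W := fun h => connectedComponentIn_subset _ _
      (hx W isPreconnected_connectedComponentIn h hfW) rfl
    rcases hm (C ∪ insert x W) (hC.union x hxC (mem_insert _ _)
      (isPreconnected_insert_connectedComponentIn_s5 hfmx)) (Or.inl hpC)
      (Or.inr (mem_insert_of_mem _ hfW)) with h | h | h
    exacts [h, absurd h.symm hne, absurd h hmW]
  have hxm' : Between p m x := hmax x hxK hfx hmx
  have hpx : p ≠ x := by
    rintro rfl
    exact hne (hmx {p} isPreconnected_singleton rfl rfl).symm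
  set Q := connectedComponentIn {x}ᶜ p
  have hpQ : p ∈ Q := mem_connectedComponentIn hpx
  have hmQ : m ∈ Q := (hmx _ (isPreconnected_insert_connectedComponentIn_s5 hpx)
    (mem_insert_of_mem _ hpQ) (mem_insert _ _)).resolve_left (Ne.symm hne)
  exact connectedComponentIn_subset _ _
    (hxm' Q isPreconnected_connectedComponentIn hpQ hmQ) rfl

end Dendrite

/-- If `f : D₁ → D₂` scrambles the boundary `E = closure (D₂ \ D₁) ∩ D₁`, i.e.,
every non-fixed point `e ∈ E` is mapped into a component of `D₂ \ {e}` meeting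
`D₁`, then `f` has a fixed point in `D₁`. -/
theorem dendrite_scrambling_fixed_point {X : Type*} [MetricSpace X] {D₁ D₂ : Set X}
    (h₁ : IsDendrite D₁) (h₂ : IsDendrite D₂) (hsub : D₁ ⊆ D₂)
    (f : X → X) (hf : ContinuousOn f D₁) (hmaps : Set.MapsTo f D₁ D₂)
    (hscr : ∀ e ∈ closure (D₂ \ D₁) ∩ D₁, f e ≠ e →
      (connectedComponentIn (D₂ \ {e}) (f e) ∩ D₁).Nonempty) :
    ∃ c ∈ D₁, f c = c := by
  classical
  obtain ⟨-, hcomp₁, hconn₁, -, -⟩ := h₁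
  obtain ⟨-, hcomp₂, hconn₂, hloc₂, hcirc₂⟩ := h₂
  have : CompactSpace D₂ := isCompact_iff_compactSpace.1 hcomp₂
  have : PreconnectedSpace D₂ := isPreconnected_iff_preconnectedSpace.1 hconn₂.isPreconnected
  let K : Set D₂ := Subtype.val ⁻¹' D₁
  let F : D₂ → D₂ := fun y => if h : y.1 ∈ D₁ then ⟨f y, hmaps h⟩ else y
  have hF : ∀ y ∈ K, (F y).1 = f y := fun y hy => by simp only [F, dif_pos (mem_preimage.1 hy)]
  have himage : Subtype.val '' K = D₁ := by
    rw [Subtype.image_preimage_coe, inter_eq_right.2 hsub]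
  suffices h : ∃ x ∈ K, F x = x by
    obtain ⟨x, hxK, hx⟩ := h
    exact ⟨x, hxK, by rw [← hF x hxK, hx]⟩
  refine exists_fixed_point_of_scrambling ?_
    (hcomp₁.isClosed.preimage continuous_subtype_val) ?_ ?_ ?_
  · exact fun c hc hci => hcirc₂ (Subtype.val ∘ c) (continuous_subtype_val.comp hc)
      (by rintro - ⟨z, rfl⟩; exact (c z).2) (Subtype.val_injective.comp hci)
  · refine ⟨?_, IsInducing.subtypeVal.isPreconnected_image.1
      (by rw [himage]; exact hconn₁.isPreconnected)⟩
    obtain ⟨y, hy⟩ := hconn₁.nonempty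
    exact ⟨⟨y, hsub hy⟩, hy⟩
  · rw [IsInducing.subtypeVal.continuousOn_iff]
    exact (hf.comp continuous_subtype_val.continuousOn fun y hy => hy).congr hF
  · rintro e ⟨heE, heK⟩ hne
    have hFe := hF e heK
    have hne' : f e ≠ e := fun h => hne (Subtype.ext (hFe.trans h))
    have heE' : e.1 ∈ closure (D₂ \ D₁) := by
      refine closure_mono ?_
        (image_closure_subset_closure_image continuous_subtype_val ⟨e, heE, rfl⟩)
      rintro - ⟨y, hy, rfl⟩
      exact ⟨y.2, hy⟩
    obtain ⟨d, hd, hd₁⟩ := hscr e ⟨heE', heK⟩ hne'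
    have hsub' := connectedComponentIn_subset (D₂ \ {e.1}) (f e)
    have hpre : IsPreconnected
        (Subtype.val ⁻¹' connectedComponentIn (D₂ \ {e.1}) (f e) : Set D₂) := by
      refine IsInducing.subtypeVal.isPreconnected_image.1 ?_
      rw [Subtype.image_preimage_coe, inter_eq_right.2 fun z hz => (hsub' hz).1]
      exact isPreconnected_connectedComponentIn
    refine ⟨⟨d, hsub hd₁⟩, hpre.subset_connectedComponentIn ?_ ?_ hd, hd₁⟩
    · rw [mem_preimage, hFe]
      exact mem_connectedComponentIn ⟨hmaps heK, hne'⟩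
    · rintro z hz rfl
      exact (hsub' hz).2 rfl
end
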